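/- Let A be a von Neumann algebra with no central summands of type I₁ (equivalently, a properly non-abelian von Neumann algebra with the stated projection P satisfying central core 0 and central carrier I). Then every nonlinear Lie n-derivation φ : A → A (n ≥ 2) is standard: φ = d + f where d is an additive derivation of A and f : A → Z(A) is a central-valued map vanishing on all (n-1)-th commutators p_n(x₁,...,xₙ). -/

import Mathlib

/-- The left-nested iterated commutator `p_n(x₁,…,xₙ) = [...[[x₁,x₂],x₃],…,xₙ]`. -/
def pComm15 {A : Type*} [Ring A] : List A → A
  | [] => 0
  | a :: t => t.foldl (fun x y => x * y - y * x) a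


set_option linter.unusedSimpArgs false
set_option linter.unusedVariables false

namespace S15

/-- The commutator. -/
def br {A : Type*} [Ring A] (x y : A) : A := x * y - y * x

/-- The algebraic context: a pair of complementary idempotents with faithfulness conditions. -/
structure Ctx {A : Type*} [Ring A] (P Q : A) : Prop where
  PP : P * P = P
  QQ : Q * Q = Q
  PQ : P * Q = 0
  QP : Q * P = 0
  one : P + Q = 1
  two : ∀ x : A, x + x = 0 → x = 0
  fP : ∀ x : A, (∀ a, x * a * P = 0) → x = 0
  fQ : ∀ x : A, (∀ a, x * a * Q = 0) → x = 0
  gP : ∀ x : A, (∀ a, P * a * x = 0) → x = 0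
  gQ : ∀ x : A, (∀ a, Q * a * x = 0) → x = 0
  sp : ∀ x : A, (∀ a, x * a * x = 0) → x = 0
  cP : ∀ b : A, P * b * P = b → (∀ a, b * (P * a * P) = (P * a * P) * b) →
    ∃ z ∈ Set.center A, z * P = b
  cQ : ∀ b : A, Q * b * Q = b → (∀ a, b * (Q * a * Q) = (Q * a * Q) * b) →
    ∃ z ∈ Set.center A, z * Q = b

section
variable {A : Type*} [Ring A] {P Q : A}

theorem Ctx.swap (h : Ctx P Q) : Ctx Q P where
  PP := h.QQ
  QQ := h.PP
  PQ := h.QP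
  QP := h.PQ
  one := by rw [add_comm]; exact h.one
  two := h.two
  fP := h.fQ
  fQ := h.fP
  gP := h.gQ
  gQ := h.gP
  sp := h.sp
  cP := h.cQ
  cQ := h.cP

theorem Ctx.PPx (h : Ctx P Q) (x : A) : P * (P * x) = P * x := by rw [← mul_assoc, h.PP]
theorem Ctx.QQx (h : Ctx P Q) (x : A) : Q * (Q * x) = Q * x := by rw [← mul_assoc, h.QQ]
theorem Ctx.PQx (h : Ctx P Q) (x : A) : P * (Q * x) = 0 := by rw [← mul_assoc, h.PQ, zero_mul]
theorem Ctx.QPx (h : Ctx P Q) (x : A) : Q * (P * x) = 0 := by rw [← mul_assoc, h.QP, zero_mul]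

/-- Peirce decomposition. -/
theorem Ctx.dec (h : Ctx P Q) (x : A) :
    x = P * x * P + P * x * Q + Q * x * P + Q * x * Q := by
  have : x = (P + Q) * x * (P + Q) := by rw [h.one]; simp
  conv_lhs => rw [this]
  noncomm_ring

theorem Ctx.ext (h : Ctx P Q) {x y : A} (h1 : P * x * P = P * y * P) (h2 : P * x * Q = P * y * Q)
    (h3 : Q * x * P = Q * y * P) (h4 : Q * x * Q = Q * y * Q) : x = y := by
  rw [h.dec x, h.dec y, h1, h2, h3, h4]

theorem cc {z : A} (hz : z ∈ Set.center A) (x : A) : z * x = x * z :=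
  (Semigroup.mem_center_iff.1 hz x).symm

theorem Ctx.e12 (h : Ctx P Q) {x : A} (hx : ∀ t, x * P * t * Q = 0) : x * P = 0 :=
  h.fQ _ (by intro a; simpa using hx a)

theorem Ctx.diag_central (h : Ctx P Q) (y : A) (hy : ∀ t, P * y * P * t * Q = P * t * Q * y * Q) :
    P * y * P + Q * y * Q ∈ Set.center A := by
  have s1 : ∀ a, P * y * P * a * P = P * a * P * y * P := by
    intro a
    have : P * y * P * a * P - P * a * P * y * P = 0 := by
      refine h.fQ _ fun t => ?_
      have e1 := hy (P * a * P * t)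
      have e2 := congrArg (fun v => P * a * P * v) (hy t)
      simp only [mul_assoc, sub_mul, h.PPx, h.PP] at e1 e2 ⊢
      rw [e1, e2, sub_self]
    exact sub_eq_zero.1 this
  have s2 : ∀ a, Q * y * Q * a * Q = Q * a * Q * y * Q := by
    intro a
    have : Q * y * Q * a * Q - Q * a * Q * y * Q = 0 := by
      refine h.gP _ fun t => ?_
      have e1 := hy (t * Q * a * Q)
      have e2 := congrArg (fun v => v * (Q * a * Q)) (hy t)
      simp only [mul_assoc, mul_sub, h.QQx, h.QQ] at e1 e2 ⊢
      rw [← e1, ← e2, sub_self]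
    exact sub_eq_zero.1 this
  have s3 : ∀ a, Q * y * Q * a * P = Q * a * P * y * P := by
    intro a
    have : Q * y * Q * a * P - Q * a * P * y * P = 0 := by
      refine h.gP _ fun t => ?_
      have e1 := congrArg (fun v => v * (a * P)) (hy t)
      have e2 := s1 (t * Q * a)
      simp only [mul_assoc, mul_sub, h.QQx, h.QQ] at e1 e2 ⊢
      rw [← e1, ← e2, sub_self]
    exact sub_eq_zero.1 this
  rw [Semigroup.mem_center_iff]
  intro g
  apply h.ext
  all_goals
    have e1 := s1 g
    have e2 := s2 g
    have e3 := s3 g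
    have e4 := hy g
    simp only [mul_assoc, mul_add, add_mul, h.PP, h.PQ, h.QP, h.QQ, h.PPx, h.PQx, h.QPx, h.QQx,
      mul_zero, add_zero, zero_add] at e1 e2 e3 e4 ⊢
    simp only [e1, e2, e3, e4]

/-- Abstract consequences of being a Lie n-derivation (`n ≥ 3`) with `φ P, φ Q` central. -/
structure LD (P Q : A) (φ : A → A) (s : Prop) : Prop where
  zP : φ P ∈ Set.center A
  zQ : φ Q ∈ Set.center A
  h1 : ∀ x y w, P * br (br x y) w * Q = br (br x y) w →
    P * φ (br (br x y) w) * Q =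
      P * (br (br (φ x) y) w + br (br x (φ y)) w + br (br x y) (φ w)) * Q
  h2 : s → ∀ x y w, P * br (br x y) w * Q = br (br x y) w →
    Q * φ (br (br x y) w) * P =
      Q * (br (br (φ x) y) w + br (br x (φ y)) w + br (br x y) (φ w)) * P
  h2' : ¬ s → ∀ x y w, P * br (br x y) w * Q = br (br x y) w →
    Q * φ (br (br x y) w) * P =
      - (Q * (br (br (φ x) y) w + br (br x (φ y)) w + br (br x y) (φ w)) * P)
  h3 : ∀ x y, P * br (br x y) Q * Q = br (br x y) Q →
    P * φ (br (br x y) Q) * P = 0 ∧ Q * φ (br (br x y) Q) * Q = 0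
  k1 : ∀ x y w, Q * br (br x y) w * P = br (br x y) w →
    Q * φ (br (br x y) w) * P =
      Q * (br (br (φ x) y) w + br (br x (φ y)) w + br (br x y) (φ w)) * P
  k2 : s → ∀ x y w, Q * br (br x y) w * P = br (br x y) w →
    P * φ (br (br x y) w) * Q =
      P * (br (br (φ x) y) w + br (br x (φ y)) w + br (br x y) (φ w)) * Q
  k2' : ¬ s → ∀ x y w, Q * br (br x y) w * P = br (br x y) w →
    P * φ (br (br x y) w) * Q =
      - (P * (br (br (φ x) y) w + br (br x (φ y)) w + br (br x y) (φ w)) * Q)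
  k3 : ∀ x y, Q * br (br x y) P * P = br (br x y) P →
    Q * φ (br (br x y) P) * Q = 0 ∧ P * φ (br (br x y) P) * P = 0

theorem LD.swap {φ : A → A} {s : Prop} (h : LD P Q φ s) : LD Q P φ s where
  zP := h.zQ
  zQ := h.zP
  h1 := h.k1
  h2 := h.k2
  h2' := h.k2'
  h3 := h.k3
  k1 := h.h1
  k2 := h.h2
  k2' := h.h2'
  k3 := h.h3



end
end S15

namespace S15
section
variable {A : Type*} [Ring A] {P Q : A}

theorem br_c {z : A} (hz : z ∈ Set.center A) (x : A) : br x z = 0 := by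
  rw [br, cc hz, sub_self]
theorem c_br {z : A} (hz : z ∈ Set.center A) (x : A) : br z x = 0 := by
  rw [br, cc hz, sub_self]
theorem br_zero (x : A) : br x 0 = 0 := by simp [br]
theorem zero_br (x : A) : br 0 x = 0 := by simp [br]
theorem add_br (x y z : A) : br (x + y) z = br x z + br y z := by simp [br]; noncomm_ring
theorem br_add (x y z : A) : br z (x + y) = br z x + br z y := by simp [br]; noncomm_ring

variable {φ : A → A} {s : Prop}

theorem LD.zero (h : Ctx P Q) (L : LD P Q φ s) : φ 0 = 0 := by
  have e1 := L.h1 0 0 0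
  have e2 := L.k1 0 0 0
  have e3 := L.h3 0 0
  simp only [br_zero, zero_br, mul_zero, zero_mul, add_zero, forall_const] at e1 e2 e3
  apply h.ext <;> simp [*]

theorem LD.d12 (h : Ctx P Q) (L : LD P Q φ s) (x : A) :
    P * (φ (P * x * Q) * P) = 0 ∧ Q * (φ (P * x * Q) * Q) = 0 := by
  have e := L.h3 (P * x * Q) Q
  have : br (br (P * x * Q) Q) Q = P * x * Q := by
    simp only [br, mul_assoc, mul_sub, sub_mul, h.PP, h.PQ, h.QP, h.QQ, h.PPx, h.PQx, h.QPx, h.QQx,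
      mul_zero, zero_mul, sub_zero]
  rw [this] at e
  simp only [mul_assoc, h.PPx, h.QQ] at e
  simpa only [mul_assoc] using e trivial

theorem LD.neg12 (h : Ctx P Q) (L : LD P Q φ s) (x : A) :
    P * (φ (-(P * (x * Q))) * Q) = -(P * (φ (P * (x * Q)) * Q)) := by
  have e := L.h1 Q (P * x * Q) Q
  have : br (br Q (P * x * Q)) Q = -(P * (x * Q)) := by
    simp only [br, mul_assoc, mul_sub, sub_mul, h.PP, h.PQ, h.QP, h.QQ, h.PPx, h.PQx, h.QPx, h.QQx,
      mul_zero, zero_mul, sub_zero, zero_sub, neg_mul, mul_neg, neg_zero]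
  rw [this, c_br L.zQ, br_c L.zQ] at e
  simp only [br, mul_assoc, mul_sub, sub_mul, h.PP, h.PQ, h.QP, h.QQ, h.PPx, h.PQx, h.QPx, h.QQx,
      mul_zero, zero_mul, sub_zero, zero_sub, neg_mul, mul_neg, zero_add, add_zero] at e
  exact e trivial

theorem LD.s12 (h : Ctx P Q) (L : LD P Q φ s) (hs : ¬ s) (x : A) :
    Q * (φ (P * x * Q) * P) = 0 := by
  have e := L.h2' hs (P * x * Q) Q Q
  have : br (br (P * x * Q) Q) Q = P * x * Q := by
    simp only [br, mul_assoc, mul_sub, sub_mul, h.PP, h.PQ, h.QP, h.QQ, h.PPx, h.PQx, h.QPx, h.QQx,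
      mul_zero, zero_mul, sub_zero]
  rw [this, br_c L.zQ, br_c L.zQ] at e
  simp only [br, mul_assoc, mul_sub, sub_mul, h.PP, h.PQ, h.QP, h.QQ, h.PPx, h.PQx, h.QPx, h.QQx,
      mul_zero, zero_mul, sub_zero, zero_sub, neg_mul, mul_neg, zero_add, add_zero, sub_neg_eq_add,
      neg_neg, neg_zero] at e
  have e := e trivial
  simp only [mul_assoc]
  exact h.two _ (by nth_rewrite 1 [e]; simp)

theorem LD.padd (h : Ctx P Q) (L : LD P Q φ s) (x : A) :
    φ (P + P * x * Q) - φ (P * x * Q) ∈ Set.center A := by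
  set m := φ (P + P * x * Q) with hm
  have key : br (br (P + P * x * Q) Q) Q = P * x * Q := by
    simp only [br, mul_assoc, mul_sub, sub_mul, mul_add, add_mul, h.PP, h.PQ, h.QP, h.QQ, h.PPx,
      h.PQx, h.QPx, h.QQx, mul_zero, zero_mul, sub_zero, zero_add, add_zero]
  have e1 := L.h1 (P + P * x * Q) Q Q
  have e2 : Q * (φ (P * x * Q) * P) = Q * (m * P) := by
    by_cases hs : s
    · have e2 := L.h2 hs (P + P * x * Q) Q Q
      rw [key, br_c L.zQ, br_c L.zQ, ← hm] at e2
      simp only [br, mul_assoc, mul_sub, sub_mul, h.PP, h.PQ, h.QP, h.QQ, h.PPx, h.PQx, h.QPx, h.QQx,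
      mul_zero, zero_mul, sub_zero, zero_sub, neg_mul, mul_neg, zero_add, add_zero, sub_neg_eq_add,
      neg_neg, neg_zero] at e2
      simpa [mul_assoc] using e2
    · have e2 := L.h2' hs (P + P * x * Q) Q Q
      rw [key, br_c L.zQ, br_c L.zQ, ← hm] at e2
      have e3 := L.s12 h hs x
      simp only [br, mul_assoc, mul_sub, sub_mul, h.PP, h.PQ, h.QP, h.QQ, h.PPx, h.PQx, h.QPx, h.QQx,
      mul_zero, zero_mul, sub_zero, zero_sub, neg_mul, mul_neg, zero_add, add_zero, sub_neg_eq_add,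
      neg_neg, neg_zero] at e2 e3
      have e2 := e2 trivial
      simp only [mul_assoc]
      rw [e3] at e2 ⊢
      rw [eq_comm, ← neg_eq_zero, ← e2]
  rw [key, br_c L.zQ, br_c L.zQ, ← hm] at e1
  simp only [br, mul_assoc, mul_sub, sub_mul, h.PP, h.PQ, h.QP, h.QQ, h.PPx, h.PQx, h.QPx, h.QQx,
      mul_zero, zero_mul, sub_zero, zero_sub, neg_mul, mul_neg, zero_add, add_zero, sub_neg_eq_add,
      neg_neg, neg_zero, forall_const] at e1
  have dc := h.diag_central m (by
    intro t
    have e := L.h1 (P + P * x * Q) (P * t * Q) Q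
    have : br (br (P + P * x * Q) (P * t * Q)) Q = P * t * Q := by
      simp only [br, mul_assoc, mul_sub, sub_mul, mul_add, add_mul, h.PP, h.PQ, h.QP, h.QQ, h.PPx,
        h.PQx, h.QPx, h.QQx, mul_zero, zero_mul, sub_zero, zero_add, add_zero]
    rw [this, br_c L.zQ, ← hm] at e
    obtain ⟨d1, d2⟩ := L.d12 h t
    have d1' : P * (φ (P * t * Q) * (P * (x * Q))) = 0 := by
      have := congrArg (· * (x * Q)) d1
      simpa [mul_assoc] using this
    simp only [br, mul_assoc, mul_sub, sub_mul, mul_add, add_mul, h.PP, h.PQ, h.QP, h.QQ, h.PPx,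
      h.PQx, h.QPx, h.QQx, mul_zero, zero_mul, sub_zero, zero_sub, neg_mul, mul_neg, zero_add,
      add_zero, sub_neg_eq_add, neg_neg, neg_zero, forall_const] at e d1 d2 d1' ⊢
    rw [d2, d1'] at e
    simp only [mul_zero, add_zero, sub_zero] at e
    rw [right_eq_add, sub_eq_zero] at e
    exact e)
  convert dc using 1
  obtain ⟨d1, d2⟩ := L.d12 h x
  apply h.ext <;>
  simp only [br, mul_assoc, mul_sub, sub_mul, mul_add, add_mul, h.PP, h.PQ, h.QP, h.QQ, h.PPx,
      h.PQx, h.QPx, h.QQx, mul_zero, zero_mul, sub_zero, zero_sub, neg_mul, mul_neg, zero_add,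
      add_zero, sub_neg_eq_add, neg_neg, neg_zero, forall_const, sub_self] at * <;> simp [*]

theorem LD.qadd (h : Ctx P Q) (L : LD P Q φ s) (x : A) :
    φ (Q + P * x * Q) - φ (P * x * Q) ∈ Set.center A := by
  set m := φ (Q + P * x * Q) with hm
  have key : br (br (Q + P * x * Q) Q) Q = P * x * Q := by
    simp only [br, mul_assoc, mul_sub, sub_mul, mul_add, add_mul, h.PP, h.PQ, h.QP, h.QQ, h.PPx,
      h.PQx, h.QPx, h.QQx, mul_zero, zero_mul, sub_zero, zero_add, add_zero]
    abel
  have e1 := L.h1 (Q + P * x * Q) Q Q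
  have e2 : Q * (φ (P * x * Q) * P) = Q * (m * P) := by
    by_cases hs : s
    · have e2 := L.h2 hs (Q + P * x * Q) Q Q
      rw [key, br_c L.zQ, br_c L.zQ, ← hm] at e2
      simp only [br, mul_assoc, mul_sub, sub_mul, h.PP, h.PQ, h.QP, h.QQ, h.PPx, h.PQx, h.QPx, h.QQx,
      mul_zero, zero_mul, sub_zero, zero_sub, neg_mul, mul_neg, zero_add, add_zero, sub_neg_eq_add,
      neg_neg, neg_zero] at e2
      simpa [mul_assoc] using e2
    · have e2 := L.h2' hs (Q + P * x * Q) Q Q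
      rw [key, br_c L.zQ, br_c L.zQ, ← hm] at e2
      have e3 := L.s12 h hs x
      simp only [br, mul_assoc, mul_sub, sub_mul, h.PP, h.PQ, h.QP, h.QQ, h.PPx, h.PQx, h.QPx, h.QQx,
      mul_zero, zero_mul, sub_zero, zero_sub, neg_mul, mul_neg, zero_add, add_zero, sub_neg_eq_add,
      neg_neg, neg_zero] at e2 e3
      have e2 := e2 trivial
      simp only [mul_assoc]
      rw [e3] at e2 ⊢
      rw [eq_comm, ← neg_eq_zero, ← e2]
  rw [key, br_c L.zQ, br_c L.zQ, ← hm] at e1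
  simp only [br, mul_assoc, mul_sub, sub_mul, h.PP, h.PQ, h.QP, h.QQ, h.PPx, h.PQx, h.QPx, h.QQx,
      mul_zero, zero_mul, sub_zero, zero_sub, neg_mul, mul_neg, zero_add, add_zero, sub_neg_eq_add,
      neg_neg, neg_zero, forall_const] at e1
  have dc := h.diag_central m (by
    intro t
    have e := L.h1 (Q + P * x * Q) (P * t * Q) Q
    have : br (br (Q + P * x * Q) (P * t * Q)) Q = -(P * (t * Q)) := by
      simp only [br, mul_assoc, mul_sub, sub_mul, mul_add, add_mul, h.PP, h.PQ, h.QP, h.QQ, h.PPx,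
        h.PQx, h.QPx, h.QQx, mul_zero, zero_mul, sub_zero, zero_add, add_zero, zero_sub,
        neg_mul, mul_neg, neg_zero]
    rw [this, br_c L.zQ, ← hm] at e
    obtain ⟨d1, d2⟩ := L.d12 h t
    have d1' : P * (φ (P * t * Q) * (P * (x * Q))) = 0 := by
      have := congrArg (· * (x * Q)) d1
      simpa [mul_assoc] using this
    simp only [L.neg12 h, br, mul_assoc, mul_sub, sub_mul, mul_add, add_mul, h.PP, h.PQ, h.QP, h.QQ,
      h.PPx,
      h.PQx, h.QPx, h.QQx, mul_zero, zero_mul, sub_zero, zero_sub, neg_mul, mul_neg, zero_add,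
      add_zero, sub_neg_eq_add, neg_neg, neg_zero, forall_const] at e d1 d2 d1' ⊢
    rw [d2, d1'] at e
    simp only [mul_zero, add_zero, sub_zero, zero_sub] at e
    grind)
  convert dc using 1
  obtain ⟨d1, d2⟩ := L.d12 h x
  apply h.ext <;>
  simp only [br, mul_assoc, mul_sub, sub_mul, mul_add, add_mul, h.PP, h.PQ, h.QP, h.QQ, h.PPx,
      h.PQx, h.QPx, h.QQx, mul_zero, zero_mul, sub_zero, zero_sub, neg_mul, mul_neg, zero_add,
      add_zero, sub_neg_eq_add, neg_neg, neg_zero, forall_const, sub_self] at * <;> simp [*]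

theorem LD.add12 (h : Ctx P Q) (L : LD P Q φ s) (x y : A) :
    φ (P * x * Q + P * y * Q) = φ (P * x * Q) + φ (P * y * Q) := by
  have key : br (br (P + P * x * Q) (Q + P * y * Q)) Q = P * x * Q + P * y * Q := by
    simp only [br, mul_assoc, mul_sub, sub_mul, mul_add, add_mul, h.PP, h.PQ, h.QP, h.QQ, h.PPx,
      h.PQx, h.QPx, h.QQx, mul_zero, zero_mul, sub_zero, zero_add, add_zero]
    try abel
  have keys : P * (P * x * Q + P * y * Q) * Q = P * x * Q + P * y * Q := by
    simp only [br, mul_assoc, mul_sub, sub_mul, mul_add, add_mul, h.PP, h.PQ, h.QP, h.QQ, h.PPx,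
      h.PQx, h.QPx, h.QQx, mul_zero, zero_mul, sub_zero, zero_add, add_zero]
  have e1 := L.h1 (P + P * x * Q) (Q + P * y * Q) Q
  have e2 := L.h2
  have c1 := L.padd h x
  have c2 := L.qadd h y
  have f1 : φ (P + P * x * Q) = φ (P * x * Q) + (φ (P + P * x * Q) - φ (P * x * Q)) := by abel
  have f2 : φ (Q + P * y * Q) = φ (P * y * Q) + (φ (Q + P * y * Q) - φ (P * y * Q)) := by abel
  have G : br (br (φ (P + P * x * Q)) (Q + P * y * Q)) Q +
      br (br (P + P * x * Q) (φ (Q + P * y * Q))) Q + br (br (P + P * x * Q) (Q + P * y * Q)) (φ Q)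
      = br (br (φ (P * x * Q)) (Q + P * y * Q)) Q + br (br (P + P * x * Q) (φ (P * y * Q))) Q := by
    rw [f1, f2, add_br (φ (P * x * Q)), br_add (φ (P * y * Q)), br_c L.zQ, br_c c2, c_br c1]
    simp only [add_zero]
  have e2 := fun hs => L.h2 hs (P + P * x * Q) (Q + P * y * Q) Q
  rw [G, key] at e1
  rw [G, key] at e2
  obtain ⟨d1, d2⟩ := L.d12 h x
  obtain ⟨d3, d4⟩ := L.d12 h y
  have key2 := L.d12 h (x + y)
  have hxy : P * (x + y) * Q = P * x * Q + P * y * Q := by noncomm_ring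
  rw [hxy] at key2
  have d1' : P * (φ (P * x * Q) * (P * (y * Q))) = 0 := by
    have := congrArg (· * (y * Q)) d1
    simpa [mul_assoc] using this
  have d3' : P * (φ (P * y * Q) * (P * (x * Q))) = 0 := by
    have := congrArg (· * (x * Q)) d3
    simpa [mul_assoc] using this
  have s3 : Q * (φ (P * x * Q + P * y * Q) * P) = Q * ((φ (P * x * Q) + φ (P * y * Q)) * P) := by
    by_cases hs : s
    · have e2 := e2 hs keys
      simp only [← mul_assoc] at e2 ⊢
      rw [e2]
      simp only [br, mul_assoc, mul_sub, sub_mul, mul_add, add_mul, h.PP, h.PQ, h.QP, h.QQ, h.PPx,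
        h.PQx, h.QPx, h.QQx, mul_zero, zero_mul, sub_zero, zero_add, add_zero, zero_sub,
        sub_neg_eq_add, neg_neg, neg_zero, mul_neg, neg_mul, d2, d4, d1, d3]
    · rw [← hxy, L.s12 h hs]
      have := L.s12 h hs x
      have := L.s12 h hs y
      simp [mul_add, add_mul, *]
  have e1 := e1 keys
  apply h.ext
  · rw [mul_assoc, key2.1, mul_add, add_mul, mul_assoc, d1, mul_assoc, d3, add_zero]
  · rw [e1]
    simp only [br, mul_assoc, mul_sub, sub_mul, mul_add, add_mul, h.PP, h.PQ, h.QP, h.QQ, h.PPx,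
        h.PQx, h.QPx, h.QQx, mul_zero, zero_mul, sub_zero, zero_add, add_zero, zero_sub,
        sub_neg_eq_add, neg_neg, neg_zero, mul_neg, neg_mul] at d1 d2 d3 d4 d1' d3' ⊢
    simp [d1, d2, d3, d4, d1', d3']
  · simp only [mul_assoc] at s3 ⊢
    exact s3
  · rw [mul_assoc, key2.2, mul_add, add_mul, mul_assoc, d2, mul_assoc, d4, add_zero]

end
end S15

namespace S15
section
variable {A : Type*} [Ring A] {P Q : A}
variable {φ : A → A} {s : Prop}

/-- Bundle of rewriting rules for the Peirce calculus. -/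
theorem Ctx.S (h : Ctx P Q) : (P * P = P ∧ P * Q = 0 ∧ Q * P = 0 ∧ Q * Q = Q) ∧
    (∀ x, P * (P * x) = P * x) ∧ (∀ x, P * (Q * x) = 0) ∧ (∀ x, Q * (P * x) = 0) ∧
    (∀ x, Q * (Q * x) = Q * x) :=
  ⟨⟨h.PP, h.PQ, h.QP, h.QQ⟩, h.PPx, h.PQx, h.QPx, h.QQx⟩

theorem left2 {x y z : A} (e : x * y = z) (w : A) : x * (y * w) = z * w := by
  rw [← mul_assoc, e]

theorem LD.fright (h : Ctx P Q) (L : LD P Q φ s) (hs : s) (t a : A) :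
    Q * (φ (P * t * (Q * a * Q)) * P) = Q * (a * (Q * (φ (P * t * Q) * P))) := by
  have key : br (br (P * t * Q) (Q * a * Q)) Q = P * t * (Q * a * Q) := by
    simp only [br, mul_assoc, mul_sub, sub_mul, mul_add, add_mul, h.S, mul_zero, zero_mul, sub_zero,
      zero_add, add_zero]
  have e := L.h2 hs (P * t * Q) (Q * a * Q) Q
  rw [key, br_c L.zQ] at e
  simp only [br, mul_assoc, mul_sub, sub_mul, mul_add, add_mul, h.S, mul_zero, zero_mul, sub_zero,
      zero_add, add_zero, zero_sub, neg_mul, mul_neg, neg_neg, sub_neg_eq_add, neg_zero] at e ⊢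
  exact e trivial

theorem LD.fleft (h : Ctx P Q) (L : LD P Q φ s) (hs : s) (t a : A) :
    Q * (φ ((P * a * P) * t * Q) * P) = Q * (φ (P * t * Q) * (P * (a * P))) := by
  have key : br (br (P * a * P) (P * t * Q)) Q = (P * a * P) * t * Q := by
    simp only [br, mul_assoc, mul_sub, sub_mul, mul_add, add_mul, h.S, mul_zero, zero_mul, sub_zero,
      zero_add, add_zero]
  have e := L.h2 hs (P * a * P) (P * t * Q) Q
  rw [key, br_c L.zQ] at e
  simp only [br, mul_assoc, mul_sub, sub_mul, mul_add, add_mul, h.S, mul_zero, zero_mul, sub_zero,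
      zero_add, add_zero, zero_sub, neg_mul, mul_neg, neg_neg, sub_neg_eq_add, neg_zero] at e ⊢
  exact e trivial

theorem LD.f0 (h : Ctx P Q) (L : LD P Q φ s) (t : A) : Q * (φ (P * t * Q) * P) = 0 := by
  by_cases hs : s
  swap
  · exact L.s12 h hs t
  have main : ∀ x z, Q * (z * (P * (x * (Q * (φ (P * t * Q) * P))))) +
      Q * (φ (P * t * Q) * (P * (x * (Q * (z * P))))) = 0 := by
    intro x z
    have key : br (br (P * x * Q) (Q * z * P)) (P * t * Q) =
        P * (x * Q * z * P * t) * Q + P * (t * Q * z * P * x) * Q := by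
      simp only [br, mul_assoc, mul_sub, sub_mul, mul_add, add_mul, h.S, mul_zero, zero_mul,
        sub_zero, zero_add, add_zero, zero_sub, neg_mul, mul_neg, neg_neg, sub_neg_eq_add, neg_zero]
    have e := L.h2 hs (P * x * Q) (Q * z * P) (P * t * Q)
    rw [key, L.add12 h] at e
    have a1 := L.fright h hs t (z * P * x)
    have a2 := L.fleft h hs t (x * Q * z)
    obtain ⟨d1, d2⟩ := L.d12 h t
    obtain ⟨d3, d4⟩ := L.d12 h x
    obtain ⟨d5, d6⟩ := L.swap.d12 h.swap z
    simp only [br, mul_assoc, mul_sub, sub_mul, mul_add, add_mul, h.S, mul_zero, zero_mul, sub_zero,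
      zero_add, add_zero, zero_sub, neg_mul, mul_neg, neg_neg, sub_neg_eq_add, neg_zero,
      forall_const] at e a1 a2 d1 d2 d3 d4 d5 d6
    rw [a1, a2] at e
    try simp only [left2 d3, left2 d4, left2 d5, left2 d6, d1, d2, d3, d4, d5, d6, mul_zero, zero_mul,
      sub_zero, zero_add, add_zero, zero_sub, neg_zero] at e
    simp only [mul_assoc]
    apply h.two
    grind
  apply h.sp
  intro a
  apply h.two
  have := main a (φ (P * t * Q))
  simpa only [mul_assoc] using this

theorem LD.c12 (h : Ctx P Q) (L : LD P Q φ s) (t : A) : P * φ (P * t * Q) * Q = φ (P * t * Q) := by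
  have e1 := L.f0 h t
  obtain ⟨d1, d2⟩ := L.d12 h t
  conv_rhs => rw [h.dec (φ (P * t * Q))]
  rw [mul_assoc Q, mul_assoc Q, mul_assoc P _ P, e1, d1, d2]
  simp

theorem LD.o11 (h : Ctx P Q) (L : LD P Q φ s) (a : A) :
    P * (φ (P * a * P) * Q) = 0 ∧ Q * (φ (P * a * P) * P) = 0 := by
  have z0 := L.zero h
  constructor
  · have key : br (br (P * a * P) Q) Q = 0 := by
      simp only [br, mul_assoc, mul_sub, sub_mul, mul_add, add_mul, h.S, mul_zero, zero_mul,
        sub_zero, zero_add, add_zero, zero_sub, neg_mul, mul_neg, neg_neg, sub_neg_eq_add, neg_zero]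
    have e := L.h1 (P * a * P) Q Q
    rw [key, br_c L.zQ, br_c L.zQ, z0] at e
    simp only [br, mul_assoc, mul_sub, sub_mul, mul_add, add_mul, h.S, mul_zero, zero_mul,
        sub_zero, zero_add, add_zero, zero_sub, neg_mul, mul_neg, neg_neg, sub_neg_eq_add, neg_zero,
        forall_const] at e ⊢
    exact e.symm
  · have key : br (br (P * a * P) P) P = 0 := by
      simp only [br, mul_assoc, mul_sub, sub_mul, mul_add, add_mul, h.S, mul_zero, zero_mul,
        sub_zero, zero_add, add_zero, zero_sub, neg_mul, mul_neg, neg_neg, sub_neg_eq_add, neg_zero,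
        sub_self]
    have e := L.k1 (P * a * P) P P
    rw [key, br_c L.zP, br_c L.zP, z0] at e
    simp only [br, mul_assoc, mul_sub, sub_mul, mul_add, add_mul, h.S, mul_zero, zero_mul,
        sub_zero, zero_add, add_zero, zero_sub, neg_mul, mul_neg, neg_neg, sub_neg_eq_add, neg_zero,
        forall_const] at e ⊢
    exact e.symm

/-- If all commutators of `v` with the corner are central in the corner, they vanish. -/
theorem Ctx.corner (h : Ctx P Q) (v : A)
    (hv : ∀ c a, br (Q * v * Q) (Q * c * Q) * (Q * a * Q) = (Q * a * Q) * br (Q * v * Q) (Q * c * Q))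
    (c : A) : br (Q * v * Q) (Q * c * Q) = 0 := by
  apply h.sp
  intro a
  set k := br (Q * v * Q) (Q * c * Q) with hk
  have hkQ : k * Q = k := by
    simp only [hk, br, sub_mul, mul_assoc, h.S]
  have hQk : Q * k = k := by
    simp only [hk, br, mul_sub, mul_assoc, h.S]
  have e1 := hv (v * Q * c) c
  have e2 : br (Q * v * Q) (Q * (v * Q * c) * Q) = (Q * v * Q) * k := by
    simp only [hk, br, mul_sub, sub_mul, mul_assoc, h.S]
  have e4 := hv c c
  rw [← hk] at e4
  rw [e2, mul_assoc, e4, ← mul_assoc (Q * v * Q), ← mul_assoc (Q * c * Q), ← sub_eq_zero, ← sub_mul] at e1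
  have e3 : k * k = 0 := by
    rw [← e1]; nth_rewrite 2 [hk]; rfl
  calc k * a * k = k * (Q * a * Q) * k := by
        nth_rewrite 1 [← hkQ]; nth_rewrite 2 [← hQk]; simp only [mul_assoc]
    _ = 0 := by rw [hv c a, ← hk, mul_assoc, e3, mul_zero]

theorem LD.c11 (h : Ctx P Q) (L : LD P Q φ s) (a : A) :
    ∃ b, P * b * P = b ∧ φ (P * a * P) - b ∈ Set.center A := by
  obtain ⟨o1, o2⟩ := L.o11 h a
  set b := φ (P * a * P) with hb
  have k0 : ∀ c, P * (br b (Q * c * Q) + br (P * a * P) (φ (Q * c * Q))) * P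
      + Q * (br b (Q * c * Q) + br (P * a * P) (φ (Q * c * Q))) * Q ∈ Set.center A := by
    intro c
    apply h.diag_central
    intro t
    have e := L.h1 (P * a * P) (Q * c * Q) (P * t * Q)
    have key : br (P * a * P) (Q * c * Q) = 0 := by
      simp only [br, mul_assoc, mul_sub, sub_mul, mul_add, add_mul, h.S, mul_zero, zero_mul,
        sub_zero, zero_add, add_zero, zero_sub, neg_mul, mul_neg, neg_neg, sub_neg_eq_add, neg_zero]
    rw [key, zero_br, zero_br, L.zero h, add_zero, ← add_br, ← hb] at e
    set w := br b (Q * c * Q) + br (P * a * P) (φ (Q * c * Q))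
    simp only [br, mul_assoc, mul_sub, sub_mul, mul_add, add_mul, h.S, mul_zero, zero_mul,
        sub_zero, zero_add, add_zero, zero_sub, neg_mul, mul_neg, neg_neg, sub_neg_eq_add, neg_zero,
        forall_const] at e ⊢
    exact sub_eq_zero.1 e.symm
  have k1 : ∀ c, Q * (br b (Q * c * Q) + br (P * a * P) (φ (Q * c * Q))) * Q =
      br (Q * b * Q) (Q * c * Q) := by
    intro c
    simp only [br, mul_assoc, mul_sub, sub_mul, mul_add, add_mul, h.S, mul_zero, zero_mul,
        sub_zero, zero_add, add_zero, zero_sub, neg_mul, mul_neg, neg_neg, sub_neg_eq_add, neg_zero]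
  have k2 := h.corner b (by
    intro c x
    have e := cc (k0 c) (Q * x * Q)
    rw [k1, add_mul _ (br (Q * b * Q) _), mul_add (Q * x * Q)] at e
    have e1 : ∀ w : A, P * w * P * (Q * x * Q) = 0 := by intro w; simp [mul_assoc, h.S]
    have e2 : ∀ w : A, (Q * x * Q) * (P * w * P) = 0 := by intro w; simp [mul_assoc, h.S]
    rw [e1, e2, zero_add, zero_add] at e
    exact e)
  obtain ⟨z, hz, hzb⟩ := h.cQ (Q * b * Q) (by simp [mul_assoc, h.S])
    (fun c => sub_eq_zero.1 (k2 c))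
  have hzQ := cc hz Q
  have hzP := cc hz P
  refine ⟨b - z, ?_, by simpa using hz⟩
  apply h.ext <;> simp only [mul_assoc, mul_sub, sub_mul, h.S, mul_zero, zero_mul, sub_zero, hzQ,
    hzP, o1, o2, sub_self]
  rw [← hzQ, hzb]
  simp only [mul_assoc, h.S, sub_self]

end
end S15

namespace S15
section
variable {A : Type*} [Ring A] {P Q : A}
variable {φ : A → A} {s : Prop}

/-- The candidate derivation attached to `φ`. -/
structure DD (P Q : A) (φ D : A → A) : Prop where
  c11 : ∀ a, P * D (P * (a * P)) * P = D (P * (a * P))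
  c12 : ∀ a, P * D (P * (a * Q)) * Q = D (P * (a * Q))
  c21 : ∀ a, Q * D (Q * (a * P)) * P = D (Q * (a * P))
  c22 : ∀ a, Q * D (Q * (a * Q)) * Q = D (Q * (a * Q))
  sum : ∀ x, D x = D (P * (x * P)) + D (P * (x * Q)) + D (Q * (x * P)) + D (Q * (x * Q))
  e12 : ∀ a, φ (P * (a * Q)) = D (P * (a * Q))
  e21 : ∀ a, φ (Q * (a * P)) = D (Q * (a * P))
  z11 : ∀ a, φ (P * (a * P)) - D (P * (a * P)) ∈ Set.center A
  z22 : ∀ a, φ (Q * (a * Q)) - D (Q * (a * Q)) ∈ Set.center A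

theorem DD.swap {D : A → A} (d : DD P Q φ D) : DD Q P φ D where
  c11 := d.c22
  c12 := d.c21
  c21 := d.c12
  c22 := d.c11
  sum x := by rw [d.sum]; abel
  e12 := d.e21
  e21 := d.e12
  z11 := d.z22
  z22 := d.z11

theorem absorb (h : Ctx P Q) {v : A} {a b : A} (ha : a * a = a) (hb : b * b = b) (hv : a * v * b = v) :
    a * v = v ∧ v * b = v ∧ (∀ y, a * (v * y) = v * y) ∧ (∀ y, v * (b * y) = v * y) := by
  have h1 : a * v = v := by rw [← hv, ← mul_assoc, ← mul_assoc, ha]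
  have h2 : v * b = v := by rw [← hv, mul_assoc, hb]
  exact ⟨h1, h2, fun y => by rw [← mul_assoc, h1], fun y => by rw [← mul_assoc, h2]⟩

theorem kill {v a b a' b' : A} (ha : a' * a = 0) (hb : b * b' = 0) (hv : a * v * b = v) :
    a' * v = 0 ∧ v * b' = 0 ∧ (∀ y, a' * (v * y) = 0) ∧ (∀ y, v * (b' * y) = 0) := by
  have h1 : a' * v = 0 := by rw [← hv, ← mul_assoc, ← mul_assoc, ha]; simp
  have h2 : v * b' = 0 := by rw [← hv, mul_assoc, hb, mul_zero]
  exact ⟨h1, h2, fun y => by rw [← mul_assoc, h1, zero_mul],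
    fun y => by rw [← mul_assoc, h2, zero_mul]⟩

variable {D : A → A}

theorem DD.S11 (h : Ctx P Q) (d : DD P Q φ D) (a : A) :
    (P * D (P * (a * P)) = D (P * (a * P)) ∧ D (P * (a * P)) * P = D (P * (a * P)) ∧
      (∀ y, P * (D (P * (a * P)) * y) = D (P * (a * P)) * y) ∧ ∀ y, D (P * (a * P)) * (P * y) = D (P * (a * P)) * y) ∧
    (Q * D (P * (a * P)) = 0 ∧ D (P * (a * P)) * Q = 0 ∧
      (∀ y, Q * (D (P * (a * P)) * y) = 0) ∧ ∀ y, D (P * (a * P)) * (Q * y) = 0) :=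
  And.intro (absorb h h.PP h.PP (d.c11 a)) (kill h.QP h.PQ (d.c11 a))
theorem DD.S12 (h : Ctx P Q) (d : DD P Q φ D) (a : A) :
    (P * D (P * (a * Q)) = D (P * (a * Q)) ∧ D (P * (a * Q)) * Q = D (P * (a * Q)) ∧
      (∀ y, P * (D (P * (a * Q)) * y) = D (P * (a * Q)) * y) ∧ ∀ y, D (P * (a * Q)) * (Q * y) = D (P * (a * Q)) * y) ∧
    (Q * D (P * (a * Q)) = 0 ∧ D (P * (a * Q)) * P = 0 ∧
      (∀ y, Q * (D (P * (a * Q)) * y) = 0) ∧ ∀ y, D (P * (a * Q)) * (P * y) = 0) :=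
  And.intro (absorb h h.PP h.QQ (d.c12 a)) (kill h.QP h.QP (d.c12 a))
theorem DD.S21 (h : Ctx P Q) (d : DD P Q φ D) (a : A) :
    (Q * D (Q * (a * P)) = D (Q * (a * P)) ∧ D (Q * (a * P)) * P = D (Q * (a * P)) ∧
      (∀ y, Q * (D (Q * (a * P)) * y) = D (Q * (a * P)) * y) ∧ ∀ y, D (Q * (a * P)) * (P * y) = D (Q * (a * P)) * y) ∧
    (P * D (Q * (a * P)) = 0 ∧ D (Q * (a * P)) * Q = 0 ∧
      (∀ y, P * (D (Q * (a * P)) * y) = 0) ∧ ∀ y, D (Q * (a * P)) * (Q * y) = 0) :=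
  And.intro (absorb h h.QQ h.PP (d.c21 a)) (kill h.PQ h.PQ (d.c21 a))
theorem DD.S22 (h : Ctx P Q) (d : DD P Q φ D) (a : A) :
    (Q * D (Q * (a * Q)) = D (Q * (a * Q)) ∧ D (Q * (a * Q)) * Q = D (Q * (a * Q)) ∧
      (∀ y, Q * (D (Q * (a * Q)) * y) = D (Q * (a * Q)) * y) ∧ ∀ y, D (Q * (a * Q)) * (Q * y) = D (Q * (a * Q)) * y) ∧
    (P * D (Q * (a * Q)) = 0 ∧ D (Q * (a * Q)) * P = 0 ∧
      (∀ y, P * (D (Q * (a * Q)) * y) = 0) ∧ ∀ y, D (Q * (a * Q)) * (P * y) = 0) :=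
  And.intro (absorb h h.QQ h.QQ (d.c22 a)) (kill h.PQ h.QP (d.c22 a))

theorem DD.p1 (h : Ctx P Q) (L : LD P Q φ s) (d : DD P Q φ D) (a x : A) :
    D (P * (a * (P * (x * Q)))) = D (P * (a * P)) * (x * Q) + P * (a * D (P * (x * Q))) := by
  have key : br (br (P * (a * P)) (P * (x * Q))) Q = P * (a * (P * (x * Q))) := by
    simp only [br, mul_assoc, mul_sub, sub_mul, mul_add, add_mul, h.S, mul_zero, zero_mul, sub_zero,
      zero_add, add_zero]
  have e := L.h1 (P * (a * P)) (P * (x * Q)) Q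
  have f1 : φ (P * (a * P)) = D (P * (a * P)) + (φ (P * (a * P)) - D (P * (a * P))) := by abel
  have e12 := d.e12 (a * (P * x))
  have c12 := d.c12 (a * (P * x))
  simp only [mul_assoc] at e12 c12
  rw [key, br_c L.zQ, f1, add_br, c_br (d.z11 a), d.e12 x, e12] at e
  simp only [br, mul_assoc, mul_sub, sub_mul, mul_add, add_mul, h.S, mul_zero, zero_mul, sub_zero,
      zero_add, add_zero, zero_sub, neg_mul, mul_neg, neg_neg, sub_neg_eq_add, neg_zero, sub_self,
      d.S11 h, d.S12 h, forall_const] at e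
  rw [← e, c12]

theorem DD.p2 (h : Ctx P Q) (L : LD P Q φ s) (d : DD P Q φ D) (x a : A) :
    D (P * (x * (Q * (a * Q)))) = D (P * (x * Q)) * (a * Q) + P * (x * D (Q * (a * Q))) := by
  have key : br (br (P * (x * Q)) (Q * (a * Q))) Q = P * (x * (Q * (a * Q))) := by
    simp only [br, mul_assoc, mul_sub, sub_mul, mul_add, add_mul, h.S, mul_zero, zero_mul, sub_zero,
      zero_add, add_zero]
  have e := L.h1 (P * (x * Q)) (Q * (a * Q)) Q
  have f1 : φ (Q * (a * Q)) = D (Q * (a * Q)) + (φ (Q * (a * Q)) - D (Q * (a * Q))) := by abel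
  have e12 := d.e12 (x * (Q * a))
  have c12 := d.c12 (x * (Q * a))
  simp only [mul_assoc] at e12 c12
  rw [key, br_c L.zQ, f1, br_add, br_c (d.z22 a), d.e12 x, e12] at e
  simp only [br, mul_assoc, mul_sub, sub_mul, mul_add, add_mul, h.S, mul_zero, zero_mul, sub_zero,
      zero_add, add_zero, zero_sub, neg_mul, mul_neg, neg_neg, sub_neg_eq_add, neg_zero, sub_self,
      d.S22 h, d.S12 h, forall_const] at e
  rw [← e, c12]

theorem DD.a12 (h : Ctx P Q) (L : LD P Q φ s) (d : DD P Q φ D) (x y : A) :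
    D (P * ((x + y) * Q)) = D (P * (x * Q)) + D (P * (y * Q)) := by
  rw [← d.e12, ← d.e12, ← d.e12]
  have := L.add12 h x y
  rw [← add_mul, ← mul_add] at this
  simpa only [mul_assoc] using this

theorem Ctx.u11 (h : Ctx P Q) {v w : A} (hv : P * v * P = v) (hw : P * w * P = w)
    (e : ∀ x, v * (x * Q) = w * (x * Q)) : v = w := by
  rw [← sub_eq_zero]
  apply h.fQ
  intro a
  rw [mul_assoc, sub_mul, e, sub_self]

theorem DD.a11 (h : Ctx P Q) (L : LD P Q φ s) (d : DD P Q φ D) (x y : A) :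
    D (P * ((x + y) * P)) = D (P * (x * P)) + D (P * (y * P)) := by
  apply h.u11 (d.c11 _) (by simp only [mul_add, add_mul, d.c11])
  intro t
  have e1 := d.p1 h L x t
  have e2 := d.p1 h L y t
  have e3 := d.p1 h L (x + y) t
  have e4 := d.a12 h L (x * (P * t)) (y * (P * t))
  simp only [add_mul, mul_add, mul_assoc] at e1 e2 e3 e4 ⊢
  rw [e4, e1, e2] at e3
  grind

theorem DD.m11 (h : Ctx P Q) (L : LD P Q φ s) (d : DD P Q φ D) (x y : A) :
    D (P * (x * (P * (y * P)))) = D (P * (x * P)) * (y * P) + P * (x * D (P * (y * P))) := by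
  have c := d.c11 (x * (P * y))
  simp only [mul_assoc] at c
  apply h.u11 (by simpa only [mul_assoc] using c)
    (by simp only [mul_assoc, mul_add, add_mul, h.S, d.S11 h])
  intro t
  have e1 := d.p1 h L (x * (P * y)) t
  have e2 := d.p1 h L x (y * (P * t))
  have e3 := d.p1 h L y t
  simp only [add_mul, mul_add, mul_assoc] at e1 e2 e3 ⊢
  rw [e3, e1] at e2
  simp only [add_mul, mul_add, mul_assoc] at e2
  grind

/-- The defect of `D` being a derivation on the off-diagonal corners. -/
def zt (D : A → A) (X Z : A) : A :=
  (D (X * Z) - D X * Z - X * D Z) + (D Z * X + Z * D X - D (Z * X))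

theorem DD.zc (h : Ctx P Q) (L : LD P Q φ s) (d : DD P Q φ D) (x z : A) :
    zt D (P * (x * Q)) (Q * (z * P)) ∈ Set.center A := by
  have c1 := d.c11 (x * (Q * z))
  have c2 := d.c22 (z * (P * x))
  simp only [mul_assoc] at c1 c2
  have c1' := And.intro (absorb h h.PP h.PP ((mul_assoc _ _ _).trans c1))
    (kill h.QP h.PQ ((mul_assoc _ _ _).trans c1))
  have c2' := And.intro (absorb h h.QQ h.QQ ((mul_assoc _ _ _).trans c2))
    (kill h.PQ h.QP ((mul_assoc _ _ _).trans c2))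
  have dc := h.diag_central (zt D (P * (x * Q)) (Q * (z * P))) (by
    intro t
    have key : br (br (P * (x * Q)) (Q * (z * P))) (P * (t * Q)) =
        P * (x * (Q * (z * (P * (t * Q))))) + P * (t * (Q * (z * (P * (x * Q))))) := by
      simp only [br, mul_assoc, mul_sub, sub_mul, mul_add, add_mul, h.S, mul_zero, zero_mul,
        sub_zero, zero_add, add_zero, zero_sub, neg_mul, mul_neg, neg_neg, sub_neg_eq_add, neg_zero]
    have e := L.h1 (P * (x * Q)) (Q * (z * P)) (P * (t * Q))
    have ad := L.add12 h (x * (Q * (z * (P * t)))) (t * (Q * (z * (P * x))))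
    have k1 := d.e12 (x * (Q * (z * (P * t))))
    have k2 := d.e12 (t * (Q * (z * (P * x))))
    have q1 := d.p1 h L (x * (Q * z)) t
    have q2 := d.p2 h L t (z * (P * x))
    simp only [mul_assoc] at ad k1 k2 q1 q2
    rw [key, ad, k1, k2, d.e12, d.e12, d.e21, q1, q2] at e
    simp only [zt, br, mul_assoc, mul_sub, sub_mul, mul_add, add_mul, h.S, mul_zero, zero_mul,
      sub_zero,
      zero_add, add_zero, zero_sub, neg_mul, mul_neg, neg_neg, sub_neg_eq_add, neg_zero, sub_self,
      d.S22 h, d.S12 h, d.S21 h, d.S11 h, c1', c2', forall_const] at e ⊢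
    clear c1' c2'
    grind)
  convert dc using 1
  simp only [zt, br, mul_assoc, mul_sub, sub_mul, mul_add, add_mul, h.S, mul_zero, zero_mul,
      sub_zero,
      zero_add, add_zero, zero_sub, neg_mul, mul_neg, neg_neg, sub_neg_eq_add, neg_zero, sub_self,
      d.S22 h, d.S12 h, d.S21 h, d.S11 h, c1', c2', forall_const]

theorem DD.zx (h : Ctx P Q) (L : LD P Q φ s) (d : DD P Q φ D) (x z : A) :
    zt D (P * (x * Q)) (Q * (z * P)) * (P * (x * Q)) = 0 := by
  have c1 := d.c11 (x * (Q * z))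
  have c2 := d.c22 (z * (P * x))
  simp only [mul_assoc] at c1 c2
  have c1' := And.intro (absorb h h.PP h.PP ((mul_assoc _ _ _).trans c1))
    (kill h.QP h.PQ ((mul_assoc _ _ _).trans c1))
  have c2' := And.intro (absorb h h.QQ h.QQ ((mul_assoc _ _ _).trans c2))
    (kill h.PQ h.QP ((mul_assoc _ _ _).trans c2))
  apply h.two
  have e := cc (d.zc h L x z) (P * (x * Q))
  nth_rewrite 1 [e]
  have q1 := d.p1 h L (x * (Q * z)) x
  have q2 := d.p2 h L x (z * (P * x))
  simp only [mul_assoc] at q1 q2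
  simp only [zt, br, mul_assoc, mul_sub, sub_mul, mul_add, add_mul, h.S, mul_zero, zero_mul,
      sub_zero,
      zero_add, add_zero, zero_sub, neg_mul, mul_neg, neg_neg, sub_neg_eq_add, neg_zero, sub_self,
      d.S22 h, d.S12 h, d.S21 h, d.S11 h, c1', c2', forall_const]
  clear c1' c2'
  grind

theorem DD.zadd (h : Ctx P Q) (L : LD P Q φ s) (d : DD P Q φ D) (x y z : A) :
    zt D (P * ((x + y) * Q)) (Q * (z * P)) = zt D (P * (x * Q)) (Q * (z * P)) +
      zt D (P * (y * Q)) (Q * (z * P)) := by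
  have a1 := d.a12 h L x y
  have a2 := d.a11 h L (x * (Q * z)) (y * (Q * z))
  have a3 := d.swap.a11 h.swap L.swap (z * (P * x)) (z * (P * y))
  simp only [zt, mul_assoc, add_mul, mul_add, h.S] at a1 a2 a3 ⊢
  rw [a1, a2, a3]
  noncomm_ring

theorem DD.z0 (h : Ctx P Q) (L : LD P Q φ s) (d : DD P Q φ D) (x z : A) :
    zt D (P * (x * Q)) (Q * (z * P)) = 0 := by
  set ζ := zt D (P * (x * Q)) (Q * (z * P)) with hζ
  have c := d.zc h L x z
  have hx := d.zx h L x z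
  rw [← hζ] at c hx
  have k : ζ * ζ = 0 := by
    apply h.fP
    intro b
    have : ζ * ζ * P = 0 := by
      apply h.e12
      intro t
      have e := d.zx h L (x + t) z
      have c2 := d.zc h L t z
      have e2 := d.zx h L t z
      rw [d.zadd h L, ← hζ] at e
      generalize zt D (P * (t * Q)) (Q * (z * P)) = ζ' at e c2 e2
      have e3 : ζ * (P * (t * Q)) + ζ' * (P * (x * Q)) = 0 := by
        have : (ζ + ζ') * (P * ((x + t) * Q)) = ζ * (P * (x * Q)) + ζ * (P * (t * Q)) +
          ζ' * (P * (x * Q)) + ζ' * (P * (t * Q)) := by noncomm_ring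
        rw [this, hx, e2] at e
        simpa using e
      have e4 : ζ * (ζ * (P * (t * Q)) + ζ' * (P * (x * Q))) = ζ * ζ * P * t * Q := by
        rw [mul_add, ← mul_assoc ζ ζ', cc c ζ', mul_assoc ζ' ζ, hx]
        simp only [mul_assoc, mul_zero, add_zero]
      rw [← e4, e3, mul_zero]
    have c3 : ζ * ζ ∈ Set.center A := Set.mul_mem_center c c
    rw [cc c3 b, mul_assoc, this, mul_zero]
  apply h.sp
  intro a
  rw [mul_assoc, ← cc c a, ← mul_assoc, k, zero_mul]

theorem DD.m12 (h : Ctx P Q) (L : LD P Q φ s) (d : DD P Q φ D) (x z : A) :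
    D (P * (x * (Q * (z * P)))) = D (P * (x * Q)) * (z * P) + P * (x * D (Q * (z * P))) := by
  have c1 := d.c11 (x * (Q * z))
  have c2 := d.c22 (z * (P * x))
  simp only [mul_assoc] at c1 c2
  have c1' := And.intro (absorb h h.PP h.PP ((mul_assoc _ _ _).trans c1))
    (kill h.QP h.PQ ((mul_assoc _ _ _).trans c1))
  have c2' := And.intro (absorb h h.QQ h.QQ ((mul_assoc _ _ _).trans c2))
    (kill h.PQ h.QP ((mul_assoc _ _ _).trans c2))
  have e := congrArg (fun v => P * v * P) (d.z0 h L x z)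
  simp only [zt, br, mul_assoc, mul_sub, sub_mul, mul_add, add_mul, h.S, mul_zero, zero_mul,
      sub_zero,
      zero_add, add_zero, zero_sub, neg_mul, mul_neg, neg_neg, sub_neg_eq_add, neg_zero, sub_self,
      d.S22 h, d.S12 h, d.S21 h, d.S11 h, c1', c2', forall_const] at e
  clear c1' c2'
  grind

theorem DD.add (h : Ctx P Q) (L : LD P Q φ s) (d : DD P Q φ D) (x y : A) :
    D (x + y) = D x + D y := by
  rw [d.sum (x + y), d.sum x, d.sum y, d.a11 h L, d.a12 h L, d.swap.a11 h.swap L.swap,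
    d.swap.a12 h.swap L.swap]
  abel

theorem DD.corner11 (h : Ctx P Q) (L : LD P Q φ s) (d : DD P Q φ D) (x y : A) :
    D (P * (x * (y * P))) = D (P * (x * P)) * (y * P) + P * (x * D (P * (y * P))) +
      D (P * (x * Q)) * (y * P) + P * (x * D (Q * (y * P))) := by
  have e : P * (x * (y * P)) = P * (x * (P * (y * P))) + P * (x * (Q * (y * P))) := by
    rw [← mul_add, ← mul_add, ← add_mul, h.one, one_mul]
  rw [e, d.add h L, d.m11 h L, d.m12 h L]
  abel

theorem DD.corner12 (h : Ctx P Q) (L : LD P Q φ s) (d : DD P Q φ D) (x y : A) :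
    D (P * (x * (y * Q))) = D (P * (x * P)) * (y * Q) + P * (x * D (P * (y * Q))) +
      D (P * (x * Q)) * (y * Q) + P * (x * D (Q * (y * Q))) := by
  have e : P * (x * (y * Q)) = P * (x * (P * (y * Q))) + P * (x * (Q * (y * Q))) := by
    rw [← mul_add, ← mul_add, ← add_mul, h.one, one_mul]
  rw [e, d.add h L, d.p1 h L, d.p2 h L]
  abel

theorem DD.mul (h : Ctx P Q) (L : LD P Q φ s) (d : DD P Q φ D) (x y : A) :
    D (x * y) = D x * y + x * D y := by
  have c1 := d.corner11 h L x y
  have c2 := d.corner12 h L x y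
  have c3 := d.swap.corner11 h.swap L.swap x y
  have c4 := d.swap.corner12 h.swap L.swap x y
  have e : D (x * y) = D (P * (x * (y * P))) + D (P * (x * (y * Q))) + D (Q * (x * (y * P))) +
    D (Q * (x * (y * Q))) := by simpa only [mul_assoc] using d.sum (x * y)
  have ex : ∀ v, P * (x * v) + Q * (x * v) = x * v := by
    intro v; rw [← add_mul, h.one, one_mul]
  have ey : ∀ v, v * (y * P) + v * (y * Q) = v * y := by
    intro v; rw [← mul_add, ← mul_add, h.one, mul_one]
  rw [e, c1, c2, c3, c4, d.sum x, d.sum y]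
  simp only [add_mul, mul_add]
  rw [← ey (D (P * (x * P))), ← ey (D (P * (x * Q))), ← ey (D (Q * (x * P))),
    ← ey (D (Q * (x * Q))), ← ex (D (P * (y * P))), ← ex (D (P * (y * Q))), ← ex (D (Q * (y * P))),
    ← ex (D (Q * (y * Q)))]
  simp only [mul_add, h.S, add_zero, zero_add]
  abel

end
end S15

namespace S15
section
variable {A : Type*} [Ring A] {P Q : A}
variable {φ : A → A} {s : Prop}

theorem Ctx.cuniq (h : Ctx P Q) {b : A} (hb : P * b * P = b) (hc : b ∈ Set.center A) : b = 0 := by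
  apply h.fQ
  intro a
  have : b * Q = 0 := by rw [← hb, mul_assoc, h.PQ, mul_zero]
  rw [cc hc a, mul_assoc, this, mul_zero]

theorem sub_center {x y : A} (hx : x ∈ Set.center A) (hy : y ∈ Set.center A) :
    x - y ∈ Set.center A := by
  rw [sub_eq_add_neg]; exact Set.add_mem_center hx (Set.neg_mem_center hy)

theorem LD.exD (h : Ctx P Q) (L : LD P Q φ s) : ∃ D, DD P Q φ D := by
  choose b1 hb1 hz1 using L.c11 h
  choose b2 hb2 hz2 using L.swap.c11 h.swap
  have z0 := L.zero h
  have u1 : ∀ a b, P * b * P = b → φ (P * a * P) - b ∈ Set.center A → b1 a = b := by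
    intro a b hb hc
    rw [← sub_eq_zero]
    apply h.cuniq
    · rw [mul_sub, sub_mul, hb, hb1]
    · have := sub_center hc (hz1 a)
      convert this using 1
      abel
  have u2 : ∀ a b, Q * b * Q = b → φ (Q * a * Q) - b ∈ Set.center A → b2 a = b := by
    intro a b hb hc
    rw [← sub_eq_zero]
    apply h.swap.cuniq
    · rw [mul_sub, sub_mul, hb, hb2]
    · have := sub_center hc (hz2 a)
      convert this using 1
      abel
  have v1 : ∀ a, P * a * P = 0 → b1 a = 0 := by
    intro a ha
    apply u1 a 0 (by simp)
    rw [ha, z0, sub_zero]; exact Set.zero_mem_center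
  have v2 : ∀ a, Q * a * Q = 0 → b2 a = 0 := by
    intro a ha
    apply u2 a 0 (by simp)
    rw [ha, z0, sub_zero]; exact Set.zero_mem_center
  let D : A → A := fun x => b1 x + φ (P * x * Q) + φ (Q * x * P) + b2 x
  have d11 : ∀ a, D (P * (a * P)) = b1 a := by
    intro a
    have e1 : b1 (P * (a * P)) = b1 a := by
      apply u1 _ _ (hb1 a)
      have := hz1 a
      simpa only [mul_assoc, h.S] using this
    have e2 : b2 (P * (a * P)) = 0 := v2 _ (by simp only [mul_assoc, h.S, mul_zero, zero_mul])
    simp only [D, e1, e2, mul_assoc, h.S, mul_zero, z0, add_zero]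
  have d22 : ∀ a, D (Q * (a * Q)) = b2 a := by
    intro a
    have e1 : b2 (Q * (a * Q)) = b2 a := by
      apply u2 _ _ (hb2 a)
      have := hz2 a
      simpa only [mul_assoc, h.S] using this
    have e2 : b1 (Q * (a * Q)) = 0 := v1 _ (by simp only [mul_assoc, h.S, mul_zero, zero_mul])
    simp only [D, e1, e2, mul_assoc, h.S, mul_zero, z0, add_zero, zero_add]
  have d12 : ∀ a, D (P * (a * Q)) = φ (P * (a * Q)) := by
    intro a
    have e1 : b1 (P * (a * Q)) = 0 := v1 _ (by simp only [mul_assoc, h.S, mul_zero, zero_mul])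
    have e2 : b2 (P * (a * Q)) = 0 := v2 _ (by simp only [mul_assoc, h.S, mul_zero, zero_mul])
    simp only [D, e1, e2, mul_assoc, h.S, mul_zero, z0, add_zero, zero_add]
  have d21 : ∀ a, D (Q * (a * P)) = φ (Q * (a * P)) := by
    intro a
    have e1 : b1 (Q * (a * P)) = 0 := v1 _ (by simp only [mul_assoc, h.S, mul_zero, zero_mul])
    have e2 : b2 (Q * (a * P)) = 0 := v2 _ (by simp only [mul_assoc, h.S, mul_zero, zero_mul])
    simp only [D, e1, e2, mul_assoc, h.S, mul_zero, z0, add_zero, zero_add]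
  refine ⟨D, ?_, ?_, ?_, ?_, ?_, ?_, ?_, ?_, ?_⟩
  · intro a; rw [d11, hb1]
  · intro a; rw [d12]; simpa only [mul_assoc] using L.c12 h a
  · intro a; rw [d21]; simpa only [mul_assoc] using L.swap.c12 h.swap a
  · intro a; rw [d22, hb2]
  · intro a; rw [d11, d12, d21, d22]; simp only [D, mul_assoc]
  · intro a; rw [d12]
  · intro a; rw [d21]
  · intro a; rw [d11]; simpa only [mul_assoc] using hz1 a
  · intro a; rw [d22]; simpa only [mul_assoc] using hz2 a

variable {D : A → A}

theorem DD.psi (h : Ctx P Q) (L : LD P Q φ s) (d : DD P Q φ D) (x y w : A)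
    (hg : P * br (br x y) w * Q = br (br x y) w) :
    P * (br (br (φ x - D x) y) w + br (br x (φ y - D y)) w + br (br x y) (φ w - D w)) * Q = 0 := by
  have e := L.h1 x y w hg
  have e2 : φ (br (br x y) w) = D (br (br x y) w) := by
    rw [← hg, mul_assoc, d.e12]
  have sub : ∀ x y, D (x - y) = D x - D y := by
    intro x y
    have := d.add h L (x - y) y
    rw [sub_add_cancel] at this
    rw [this]; abel
  have db : ∀ x y, D (br x y) = br (D x) y + br x (D y) := by
    intro x y
    simp only [br, sub, d.mul h L]
    noncomm_ring
  rw [e2, db, db] at e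
  rw [← sub_eq_zero] at e
  rw [← neg_eq_zero, ← e]
  simp only [br]
  noncomm_ring

theorem DD.psi_diag (h : Ctx P Q) (L : LD P Q φ s) (d : DD P Q φ D) (x : A) :
    P * (φ x - D x) * P + Q * (φ x - D x) * Q ∈ Set.center A := by
  apply h.diag_central
  intro t
  have zq : φ Q - D Q ∈ Set.center A := by
    have := d.z22 1
    simpa only [one_mul, h.S] using this
  have e := d.psi h L x (P * (t * Q)) Q (by
    simp only [br, mul_assoc, mul_sub, sub_mul, mul_add, add_mul, h.S, mul_zero, zero_mul, sub_zero,
      zero_add, add_zero, zero_sub, neg_mul, mul_neg, neg_neg, sub_neg_eq_add, neg_zero]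
    have ex : P * (x * (P * (t * Q))) + Q * (x * (P * (t * Q))) = x * (P * (t * Q)) := by
      rw [← add_mul, h.one, one_mul]
    rw [← ex]
    simp only [mul_add, h.S, add_zero]
    abel)
  rw [d.e12, sub_self, br_zero, zero_br, br_c zq] at e
  generalize φ x - D x = v at e ⊢
  simp only [br, mul_assoc, mul_sub, sub_mul, mul_add, add_mul, h.S, mul_zero, zero_mul, sub_zero,
      zero_add, add_zero, zero_sub, neg_mul, mul_neg, neg_neg, sub_neg_eq_add, neg_zero, sub_self] at e ⊢
  exact sub_eq_zero.1 e

theorem Ctx.tus (h : Ctx P Q) (v : A) (hv : ∀ t s, P * (t * (Q * (v * (P * (s * Q))))) +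
    P * (s * (Q * (v * (P * (t * Q))))) = 0) : Q * v * P = 0 := by
  have h1 : ∀ t, P * (t * (Q * (v * (P * (t * Q))))) = 0 := fun t => h.two _ (hv t t)
  have h2 : ∀ t, Q * v * P * t * Q * v * P = 0 := by
    intro t
    apply h.sp
    intro a
    have e1 := hv t a
    have e2 : P * t * Q * v * P * a * Q * v * P * t * Q = 0 := by
      have e3 := congrArg (fun y => y * (v * (P * (t * Q)))) e1
      simp only [add_mul, zero_mul, mul_assoc, h.S] at e3 ⊢
      rw [h1 t] at e3
      simpa using e3
    have e4 := congrArg (fun y => Q * v * y * v * P) e2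
    simp only [mul_assoc, zero_mul, mul_zero, h.S] at e4 ⊢
    exact e4
  apply h.sp
  intro a
  have := h2 a
  simpa only [mul_assoc] using this

theorem DD.psi_off (h : Ctx P Q) (L : LD P Q φ s) (d : DD P Q φ D) (x : A) :
    Q * (φ x - D x) * P = 0 := by
  apply h.tus
  intro t u
  have e := d.psi h L x (P * (t * Q)) (P * (u * Q)) (by
    simp only [br, mul_assoc, mul_sub, sub_mul, mul_add, add_mul, h.S, mul_zero, zero_mul, sub_zero,
      zero_add, add_zero, zero_sub, neg_mul, mul_neg, neg_neg, sub_neg_eq_add, neg_zero]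
    try abel)
  rw [d.e12, d.e12, sub_self, sub_self, br_zero, zero_br, br_zero] at e
  generalize φ x - D x = v at e ⊢
  simp only [br, mul_assoc, mul_sub, sub_mul, mul_add, add_mul, h.S, mul_zero, zero_mul, sub_zero,
      zero_add, add_zero, zero_sub, neg_mul, mul_neg, neg_neg, sub_neg_eq_add, neg_zero, sub_self] at e ⊢
  rw [← neg_eq_zero, ← e]
  abel

theorem DD.psi_central (h : Ctx P Q) (L : LD P Q φ s) (d : DD P Q φ D) (x : A) :
    φ x - D x ∈ Set.center A := by
  have e := d.psi_diag h L x
  have e1 := d.psi_off h L x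
  have e2 := d.swap.psi_off h.swap L.swap x
  rw [h.dec (φ x - D x), e1, e2]
  simpa using e

theorem LD.main (h : Ctx P Q) (L : LD P Q φ s) : ∃ D : A → A, (∀ x y, D (x + y) = D x + D y) ∧
    (∀ x y, D (x * y) = D x * y + x * D y) ∧ ∀ x, φ x - D x ∈ Set.center A := by
  obtain ⟨D, d⟩ := L.exD h
  exact ⟨D, d.add h L, d.mul h L, d.psi_central h L⟩
end
end S15

namespace S15
section
variable {A : Type*} [Ring A] {P Q : A}
variable {φ : A → A} {s : Prop}

/-- One step of the Leibniz expansion: track an iterated commutator and its formal derivative. -/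
def pf (φ : A → A) (v : A × A) (y : A) : A × A := (br v.1 y, br v.2 y + br v.1 (φ y))

/-- Lie derivation identity in fold form. -/
def HL (φ : A → A) (M : ℕ) : Prop :=
  ∀ (a : A) (l : List A), l.length = M → φ (l.foldl br a) = (l.foldl (pf φ) (a, φ a)).2

theorem foldl_add (l : List A) : ∀ a b : A, l.foldl br (a + b) = l.foldl br a + l.foldl br b := by
  induction l with
  | nil => intro a b; rfl
  | cons y l ih => intro a b; simp only [List.foldl_cons, add_br, ih]

theorem foldl_zero (l : List A) : l.foldl br (0 : A) = 0 := by
  induction l with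
  | nil => rfl
  | cons y l ih => simp only [List.foldl_cons, zero_br, ih]

theorem pf_sum (φ : A → A) : ∀ (k : ℕ) (x : Fin k → A) (a b : A),
    (List.ofFn x).foldl (pf φ) (a, b) = ((List.ofFn x).foldl br a,
      (List.ofFn x).foldl br b +
        ∑ i, (List.ofFn (Function.update x i (φ (x i)))).foldl br a) := by
  intro k
  induction k with
  | zero => intro x a b; simp
  | succ k ih =>
    intro x a b
    rw [Fin.sum_univ_succ]
    simp only [List.ofFn_succ, List.foldl_cons]
    have e : pf φ (a, b) (x 0) = (br a (x 0), br b (x 0) + br a (φ (x 0))) := rfl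
    rw [e, ih, foldl_add]
    have e2 : ∀ i : Fin k, (fun j : Fin k => Function.update x i.succ (φ (x i.succ)) j.succ) =
        Function.update (fun j : Fin k => x j.succ) i (φ (x i.succ)) := by
      intro i
      funext j
      by_cases hj : j = i
      · subst hj; simp
      · have : j.succ ≠ i.succ := fun hh => hj (Fin.succ_injective _ hh)
        simp [Function.update_of_ne, hj, this]
    have e3 : ∀ i : Fin k, Function.update x i.succ (φ (x i.succ)) 0 = x 0 := by
      intro i
      exact Function.update_of_ne (Fin.succ_ne_zero i).symm _ _
    have e4 : (fun j : Fin k => Function.update x 0 (φ (x 0)) j.succ) = fun j => x j.succ := by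
      funext j
      exact Function.update_of_ne (Fin.succ_ne_zero j) _ _
    simp only [e2, e3, e4, Function.update_self]
    rw [add_assoc]

theorem pComm_sum (φ : A → A) (k : ℕ) (x : Fin (k + 1) → A) :
    ∑ i, pComm15 (List.ofFn (Function.update x i (φ (x i)))) =
      ((List.ofFn fun i : Fin k => x i.succ).foldl (pf φ) (x 0, φ (x 0))).2 := by
  rw [pf_sum, Fin.sum_univ_succ]
  have e2 : ∀ i : Fin k, (fun j : Fin k => Function.update x i.succ (φ (x i.succ)) j.succ) =
      Function.update (fun j : Fin k => x j.succ) i (φ (x i.succ)) := by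
    intro i
    funext j
    by_cases hj : j = i
    · subst hj; simp
    · have : j.succ ≠ i.succ := fun hh => hj (Fin.succ_injective _ hh)
      simp [Function.update_of_ne, hj, this]
  have e3 : ∀ i : Fin k, Function.update x i.succ (φ (x i.succ)) 0 = x 0 := by
    intro i
    exact Function.update_of_ne (Fin.succ_ne_zero i).symm _ _
  have e4 : (fun j : Fin k => Function.update x 0 (φ (x 0)) j.succ) = fun j => x j.succ := by
    funext j
    exact Function.update_of_ne (Fin.succ_ne_zero j) _ _
  simp only [List.ofFn_succ, e2, e3, e4, Function.update_self, pComm15]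
  rfl

theorem HL_of (φ : A → A) (k : ℕ) (hφ : ∀ x : Fin (k + 1) → A,
      φ (pComm15 (List.ofFn x))
        = ∑ i, pComm15 (List.ofFn (Function.update x i (φ (x i))))) : HL φ k := by
  intro a l hl
  subst hl
  have := hφ (Fin.cons a l.get)
  rw [pComm_sum] at this
  simp only [List.ofFn_succ, Fin.cons_zero, Fin.cons_succ, pComm15, List.ofFn_get] at this
  exact this

theorem HL.two (hL : HL φ 1) : HL φ 2 := by
  intro a l hl
  obtain ⟨y, w, rfl⟩ : ∃ y w, l = [y, w] := List.length_eq_two.1 hl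
  have e1 := hL a [y] rfl
  have e2 := hL (br a y) [w] rfl
  simp only [List.foldl_cons, List.foldl_nil, pf] at e1 e2 ⊢
  rw [e2, e1]

theorem HL.sub {M : ℕ} (hL : HL φ M) {d : A → A} (da : ∀ x y, d (x + y) = d x + d y)
    (dm : ∀ x y, d (x * y) = d x * y + x * d y) : HL (fun x => φ x - d x) M := by
  have sub : ∀ x y, d (x - y) = d x - d y := by
    intro x y
    have := da (x - y) y
    rw [sub_add_cancel] at this
    rw [this]; abel
  have db : ∀ x y, d (br x y) = br (d x) y + br x (d y) := by
    intro x y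
    simp only [br, sub, dm]
    noncomm_ring
  have key : ∀ (l : List A) (a b : A), l.foldl (pf fun x => φ x - d x) (a, b - d a) =
      (l.foldl br a, (l.foldl (pf φ) (a, b)).2 - d (l.foldl br a)) := by
    intro l
    induction l with
    | nil => intro a b; rfl
    | cons y l ih =>
      intro a b
      simp only [List.foldl_cons]
      have e : pf (fun x => φ x - d x) (a, b - d a) y =
          (br a y, (br b y + br a (φ y)) - d (br a y)) := by
        simp only [pf, db]
        congr 1
        simp only [br]
        noncomm_ring
      rw [e, ih]
      rfl
  intro a l hl
  rw [key]
  simp only [hL a l hl]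

theorem HL.central {M : ℕ} (hL : HL φ M) (hM : 1 ≤ M) (hc : ∀ x, φ x ∈ Set.center A) (a : A) (l : List A)
    (hl : l.length = M) : φ (l.foldl br a) = 0 := by
  rw [hL a l hl]
  have key : ∀ (l : List A) (a : A), (l.foldl (pf φ) (a, 0)).2 = 0 := by
    intro l
    induction l with
    | nil => intro a; rfl
    | cons y l ih =>
      intro a
      have e : pf φ (a, 0) y = (br a y, 0) := by
        simp only [pf, zero_br, br_c (hc y), add_zero]
      rw [List.foldl_cons, e, ih]
  cases l with
  | nil => simp at hl; omega
  | cons y l =>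
    have e : pf φ (a, φ a) y = (br a y, 0) := by
      simp only [pf, c_br (hc a), br_c (hc y), add_zero]
    rw [List.foldl_cons, e, key]

theorem HL.zero {M : ℕ} (hL : HL φ M) (hM : 1 ≤ M) : φ 0 = 0 := by
  obtain ⟨m, rfl⟩ : ∃ m, M = m + 1 := ⟨M - 1, by omega⟩
  have key : ∀ (m : ℕ) , ((List.replicate m 0).foldl (pf φ) ((0 : A), 0)).2 = 0 := by
    intro m
    induction m with
    | zero => rfl
    | succ m ih =>
      have e : pf φ (0, 0) 0 = (0, 0) := by simp only [pf, zero_br, br_zero, add_zero]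
      rw [List.replicate_succ, List.foldl_cons, e, ih]
  have := hL 0 (List.replicate (m + 1) 0) (by simp)
  have e : pf φ (0, φ 0) 0 = (0, 0) := by simp only [pf, zero_br, br_zero, add_zero]
  rw [foldl_zero, List.replicate_succ, List.foldl_cons, e, key] at this
  exact this

theorem rep_pf (hQ : φ Q ∈ Set.center A) (k : ℕ) : ∀ v b,
    (List.replicate k Q).foldl (pf φ) (v, b) =
      ((List.replicate k Q).foldl br v, (List.replicate k Q).foldl br b) := by
  induction k with
  | zero => intro v b; rfl
  | succ k ih =>
    intro v b
    have e : pf φ (v, b) Q = (br v Q, br b Q) := by simp only [pf, br_c hQ, add_zero]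
    rw [List.replicate_succ, List.foldl_cons, e, ih]
    rfl

theorem Ctx.rep12 (h : Ctx P Q) (k : ℕ) : ∀ v,
    P * (List.replicate k Q).foldl br v * Q = P * v * Q := by
  induction k with
  | zero => intro v; rfl
  | succ k ih =>
    intro v
    rw [List.replicate_succ, List.foldl_cons, ih]
    simp only [br, mul_sub, sub_mul, mul_assoc, h.S, mul_zero, sub_zero]

theorem Ctx.rep21 (h : Ctx P Q) (k : ℕ) : ∀ v,
    Q * (List.replicate k Q).foldl br v * P = (-1) ^ k * (Q * v * P) := by
  induction k with
  | zero => intro v; simp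
  | succ k ih =>
    intro v
    rw [List.replicate_succ, List.foldl_cons, ih, pow_succ]
    simp only [br, mul_sub, sub_mul, mul_assoc, h.S, mul_zero, sub_zero]
    simp

theorem Ctx.repd (h : Ctx P Q) (k : ℕ) : ∀ v, P * v * P = 0 → Q * v * Q = 0 →
    P * (List.replicate k Q).foldl br v * P = 0 ∧ Q * (List.replicate k Q).foldl br v * Q = 0 := by
  induction k with
  | zero => intro v h1 h2; exact ⟨h1, h2⟩
  | succ k ih =>
    intro v h1 h2
    rw [List.replicate_succ, List.foldl_cons]
    apply ih
    all_goals simp only [br, mul_sub, sub_mul, mul_assoc, h.S, mul_zero, sub_zero, zero_mul, sub_self]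

theorem Ctx.rep1 (h : Ctx P Q) (k : ℕ) (v : A) (hv : P * v * Q = v) :
    (List.replicate k Q).foldl br v = v := by
  induction k with
  | zero => rfl
  | succ k ih =>
    have : br v Q = v := by
      rw [← hv]
      simp only [br, mul_sub, sub_mul, mul_assoc, h.S, mul_zero, sub_zero]
    rw [List.replicate_succ, List.foldl_cons, this, ih]

theorem HL.step0 (h : Ctx P Q) (tf : ∀ (k : ℕ) (x : A), k ≠ 0 → k • x = 0 → x = 0)
    {M : ℕ} (hL : HL φ M) (hM : 1 ≤ M) : P * φ Q * P + Q * φ Q * Q ∈ Set.center A := by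
  apply h.diag_central
  intro t
  set x := P * t * Q with hx
  have hx1 : P * x * Q = x := by simp only [hx, mul_assoc, h.S]
  have hxQ : br x Q = x := by
    simp only [hx, br, mul_sub, sub_mul, mul_assoc, h.S, mul_zero, sub_zero]
  have key : ∀ (k : ℕ) (b : A), P * ((List.replicate k Q).foldl (pf φ) (x, b)).2 * Q =
      P * b * Q + k • (P * br x (φ Q) * Q) := by
    intro k
    induction k with
    | zero => intro b; simp
    | succ k ih =>
      intro b
      have e : pf φ (x, b) Q = (x, br b Q + br x (φ Q)) := by simp only [pf, hxQ]
      rw [List.replicate_succ, List.foldl_cons, e, ih]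
      have e2 : P * br b Q * Q = P * b * Q := by
        simp only [br, mul_sub, sub_mul, mul_assoc, h.S, mul_zero, sub_zero]
      rw [mul_add, add_mul, e2, add_smul, one_smul]
      abel
  have e := hL x (List.replicate M Q) (by simp)
  rw [h.rep1 M x hx1] at e
  have e2 := key M (φ x)
  rw [← e] at e2
  have e3 := tf M _ (by omega) (by simpa using e2.symm)
  simp only [br, hx, mul_sub, sub_mul, mul_assoc, h.S, mul_zero, sub_zero] at e3 ⊢
  exact (sub_eq_zero.1 e3).symm

theorem HL.half (h : Ctx P Q) {m : ℕ} (hL : HL φ (m + 2)) (hQ : φ Q ∈ Set.center A) (x y w : A)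
    (hg : P * br (br x y) w * Q = br (br x y) w) :
    φ (br (br x y) w) = (List.replicate m Q).foldl br
      (br (br (φ x) y) w + br (br x (φ y)) w + br (br x y) (φ w)) := by
  have e := hL x (y :: w :: List.replicate m Q) (by simp)
  simp only [List.foldl_cons] at e
  rw [h.rep1 m _ hg] at e
  rw [e]
  simp only [pf, add_br, rep_pf hQ]

theorem HL.half1 (h : Ctx P Q) {m : ℕ} (hL : HL φ (m + 2)) (hQ : φ Q ∈ Set.center A) (x y w : A)
    (hg : P * br (br x y) w * Q = br (br x y) w) :
    P * φ (br (br x y) w) * Q =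
      P * (br (br (φ x) y) w + br (br x (φ y)) w + br (br x y) (φ w)) * Q := by
  rw [hL.half h hQ x y w hg, h.rep12]

theorem HL.half2 (h : Ctx P Q) {m : ℕ} (hL : HL φ (m + 2)) (hQ : φ Q ∈ Set.center A) (x y w : A)
    (hg : P * br (br x y) w * Q = br (br x y) w) :
    Q * φ (br (br x y) w) * P = (-1) ^ m *
      (Q * (br (br (φ x) y) w + br (br x (φ y)) w + br (br x y) (φ w)) * P) := by
  rw [hL.half h hQ x y w hg, h.rep21]

theorem HL.half3 (h : Ctx P Q) {m : ℕ} (hL : HL φ (m + 2)) (hQ : φ Q ∈ Set.center A) (x y : A)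
    (hg : P * br (br x y) Q * Q = br (br x y) Q) :
    P * φ (br (br x y) Q) * P = 0 ∧ Q * φ (br (br x y) Q) * Q = 0 := by
  rw [hL.half h hQ x y Q hg, br_c hQ, add_zero, ← add_br]
  apply h.repd
  all_goals simp only [br, mul_sub, sub_mul, mul_assoc, h.S, mul_zero, sub_zero, zero_mul, sub_self]

theorem HL.LD (h : Ctx P Q) {m : ℕ} (hL : HL φ (m + 2)) (hP : φ P ∈ Set.center A)
    (hQ : φ Q ∈ Set.center A) : LD P Q φ (Even m) where
  zP := hP
  zQ := hQ
  h1 := hL.half1 h hQ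
  h2 hm x y w hg := by rw [hL.half2 h hQ x y w hg, hm.neg_one_pow, one_mul]
  h2' hm x y w hg := by
    rw [hL.half2 h hQ x y w hg, (Nat.not_even_iff_odd.1 hm).neg_one_pow, neg_one_mul]
  h3 := hL.half3 h hQ
  k1 := hL.half1 h.swap hP
  k2 hm x y w hg := by rw [hL.half2 h.swap hP x y w hg, hm.neg_one_pow, one_mul]
  k2' hm x y w hg := by
    rw [hL.half2 h.swap hP x y w hg, (Nat.not_even_iff_odd.1 hm).neg_one_pow, neg_one_mul]
  k3 := hL.half3 h.swap hP

theorem HL.main0 (h : Ctx P Q) (tf : ∀ (k : ℕ) (x : A), k ≠ 0 → k • x = 0 → x = 0)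
    {m : ℕ} (hL : HL φ (m + 2)) : ∃ D : A → A, (∀ x y, D (x + y) = D x + D y) ∧
    (∀ x y, D (x * y) = D x * y + x * D y) ∧ ∀ x, φ x - D x ∈ Set.center A := by
  set T := Q * φ Q * P - P * φ Q * Q with hT
  set d : A → A := fun x => br x T with hd
  have da : ∀ x y, d (x + y) = d x + d y := fun x y => add_br x y T
  have dm : ∀ x y, d (x * y) = d x * y + x * d y := by
    intro x y; simp only [hd, br]; noncomm_ring
  have s0 := hL.step0 h tf (by omega)
  have hL' := hL.sub da dm
  set φ' : A → A := fun x => φ x - d x with hφ'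
  have hQ : φ' Q ∈ Set.center A := by
    convert s0 using 1
    simp only [hφ', hd, hT]
    nth_rewrite 1 [h.dec (φ Q)]
    simp only [br, mul_sub, sub_mul, mul_assoc, h.S, mul_zero, sub_zero, zero_mul, zero_sub]
    abel
  have s1 := hL'.step0 h.swap (fun k x => tf k x) (by omega)
  have hP : φ' P ∈ Set.center A := by
    have e := hL' P (List.replicate (m + 2) Q) (by simp)
    rw [rep_pf hQ] at e
    have e0 : br P Q = 0 := by simp only [br, h.S, sub_self]
    rw [List.replicate_succ, List.foldl_cons, e0, foldl_zero, hL'.zero (by omega),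
      ← List.replicate_succ] at e
    simp only at e
    have e1 := h.rep12 (m + 2) (φ' P)
    have e2 := h.rep21 (m + 2) (φ' P)
    rw [List.replicate_succ] at e1 e2
    rw [← List.replicate_succ, ← e] at e1 e2
    have e3 : P * φ' P * Q = 0 := by rw [← e1]; simp
    have e4 : Q * φ' P * P = 0 := by
      have : (-1 : A) ^ (m + 2) * ((-1) ^ (m + 2) * (Q * φ' P * P)) = 0 := by rw [← e2]; simp
      rwa [← mul_assoc, ← pow_add, Even.neg_one_pow ⟨m + 2, rfl⟩, one_mul] at this
    rw [h.dec (φ' P), e3, e4]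
    convert s1 using 1
    abel
  obtain ⟨D, Da, Dm, Dc⟩ := (hL'.LD h hP hQ).main h
  refine ⟨fun x => d x + D x, ?_, ?_, ?_⟩
  · intro x y; simp only [da, Da]; abel
  · intro x y; simp only [dm, Dm]; noncomm_ring
  · intro x
    have := Dc x
    simpa only [hφ', sub_sub] using this

theorem alg_main (h : Ctx P Q) (tf : ∀ (k : ℕ) (x : A), k ≠ 0 → k • x = 0 → x = 0)
    (n : ℕ) (hn : 2 ≤ n) (φ : A → A)
    (hφ : ∀ x : Fin n → A,
      φ (pComm15 (List.ofFn x))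
        = ∑ i, pComm15 (List.ofFn (Function.update x i (φ (x i))))) :
    ∃ d f : A → A,
      (∀ x y : A, d (x + y) = d x + d y) ∧
      (∀ x y : A, d (x * y) = d x * y + x * d y) ∧
      (∀ x : A, f x ∈ Set.center A) ∧
      (∀ x : A, φ x = d x + f x) ∧
      (∀ x : Fin n → A, f (pComm15 (List.ofFn x)) = 0) := by
  obtain ⟨k, rfl⟩ : ∃ k, n = k + 2 := ⟨n - 2, by omega⟩
  have hL : HL φ (k + 1) := HL_of φ (k + 1) hφ
  have hm : ∃ m, HL φ (m + 2) := by
    cases k with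
    | zero => exact ⟨0, hL.two⟩
    | succ k => exact ⟨k, hL⟩
  obtain ⟨m, hm⟩ := hm
  obtain ⟨D, Da, Dm, Dc⟩ := hm.main0 h tf
  refine ⟨D, fun x => φ x - D x, Da, Dm, Dc, fun x => (add_sub_cancel _ _).symm, ?_⟩
  intro x
  have := (hL.sub Da Dm).central (by omega) Dc (x 0) (List.ofFn fun i : Fin (k + 1) => x i.succ) (by simp)
  rw [List.ofFn_succ]
  exact this

end
end S15

namespace S15
section
variable {A : Type*} [CStarAlgebra A]

/-- Families of closed balls in a dual space with the finite intersection property intersect. -/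
theorem ball_fip [WStarAlgebra A] {ι : Type*} [Nonempty ι] (c : ι → A) (r : ι → ℝ)
    (h : ∀ F : Finset ι, ∃ x, ∀ i ∈ F, ‖x - c i‖ ≤ r i) : ∃ x, ∀ i, ‖x - c i‖ ≤ r i := by
  obtain ⟨X, _, _, _, ⟨e⟩⟩ := WStarAlgebra.exists_predual (M := A)
  let K : ι → Set (WeakDual ℂ X) := fun i =>
    WeakDual.toStrongDual ⁻¹' Metric.closedBall (e.symm (c i)) (r i)
  obtain ⟨i0⟩ := ‹Nonempty ι›
  have key : ∀ (x : A) (i : ι), ‖x - c i‖ ≤ r i ↔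
      StrongDual.toWeakDual (e.symm x) ∈ K i := by
    intro x i
    simp only [K, Set.mem_preimage, Metric.mem_closedBall, dist_eq_norm]
    have : (WeakDual.toStrongDual (StrongDual.toWeakDual (e.symm x))) = e.symm x := rfl
    rw [this, ← map_sub, LinearIsometryEquiv.norm_map]
  obtain ⟨y, -, hy⟩ := IsCompact.inter_iInter_nonempty
    (WeakDual.isCompact_closedBall (e.symm (c i0)) (r i0) : IsCompact (K i0)) K
    (fun i => WeakDual.isClosed_closedBall _ _) (by
      classical
      intro F
      obtain ⟨x, hx⟩ := h (insert i0 F)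
      refine ⟨StrongDual.toWeakDual (e.symm x), (key x i0).1 (hx _ (by simp)), ?_⟩
      simp only [Set.mem_iInter]
      intro i hi
      exact (key x i).1 (hx _ (by simp [hi])))
  rw [Set.mem_iInter] at hy
  refine ⟨e (WeakDual.toStrongDual y), fun i => ?_⟩
  rw [key]
  have : StrongDual.toWeakDual (e.symm (e (WeakDual.toStrongDual y))) = y := by
    rw [LinearIsometryEquiv.symm_apply_apply]; rfl
  rw [this]
  exact hy i

variable [PartialOrder A] [StarOrderedRing A]

theorem nb (y : A) (r : ℝ) (hr : 0 ≤ r) (h1 : -algebraMap ℝ A r ≤ y) (h2 : y ≤ algebraMap ℝ A r) :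
    IsSelfAdjoint y ∧ y * y ≤ algebraMap ℝ A (r ^ 2) ∧ ‖y‖ ≤ r := by
  have h3 : 0 ≤ algebraMap ℝ A r - y := sub_nonneg.2 h2
  have h4 : 0 ≤ algebraMap ℝ A r + y := by rwa [neg_le_iff_add_nonneg, add_comm] at h1
  have sa : IsSelfAdjoint y := by
    have := (IsSelfAdjoint.of_nonneg h4).sub (IsSelfAdjoint.algebraMap A (.all r))
    simpa using this
  have h5 : y * y ≤ algebraMap ℝ A (r ^ 2) := by
    have c : Commute (algebraMap ℝ A r) y := Algebra.commutes r y
    have := Commute.mul_nonneg h3 h4 (by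
      apply Commute.sub_left <;> apply Commute.add_right <;> first | exact c | exact c.symm | exact Commute.refl _)
    rw [← sub_nonneg]
    convert this using 1
    rw [sub_mul, mul_add, mul_add, pow_two, map_mul, c.eq]
    abel
  refine ⟨sa, h5, ?_⟩
  have h6 : 0 ≤ y * y := by simpa [sa.star_eq] using star_mul_self_nonneg y
  have h7 := (CStarAlgebra.norm_le_iff_le_algebraMap (y * y) (sq_nonneg r) h6).2 h5
  have h8 : ‖y‖ * ‖y‖ = ‖y * y‖ := by rw [← CStarRing.norm_star_mul_self, sa.star_eq]
  nlinarith [norm_nonneg y]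

theorem ival_aux (y : A) (r : ℝ) (hr : 0 ≤ r) : (-algebraMap ℝ A r ≤ y ∧ y ≤ algebraMap ℝ A r) ↔
    ∀ t : ℝ, ‖y + algebraMap ℂ A (t * Complex.I)‖ ≤ Real.sqrt (r ^ 2 + t ^ 2) := by
  constructor
  · rintro ⟨h1, h2⟩ t
    obtain ⟨sa, h3, h4⟩ := nb y r hr h1 h2
    apply Real.le_sqrt_of_sq_le
    rw [pow_two, ← CStarRing.norm_star_mul_self]
    have e : star (y + algebraMap ℂ A (t * Complex.I)) * (y + algebraMap ℂ A (t * Complex.I)) =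
        y * y + algebraMap ℝ A (t ^ 2) := by
      rw [star_add, sa.star_eq, ← algebraMap_star_comm, add_mul, mul_add, mul_add,
        ← map_mul, ← Algebra.commutes (t * Complex.I) y]
      have : (star (t * Complex.I) : ℂ) = - (t * Complex.I) := by simp
      rw [this, map_neg]
      have : (- (t * Complex.I) * (t * Complex.I) : ℂ) = ((t ^ 2 : ℝ) : ℂ) := by
        push_cast
        linear_combination (-(t : ℂ) ^ 2) * Complex.I_sq
      rw [this]
      have : algebraMap ℂ A ((t ^ 2 : ℝ) : ℂ) = algebraMap ℝ A (t ^ 2) := by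
        rw [IsScalarTower.algebraMap_apply ℝ ℂ A]; rfl
      rw [this]
      noncomm_ring
    rw [CStarAlgebra.norm_le_iff_le_algebraMap _ (by positivity) (star_mul_self_nonneg _), e, map_add]
    gcongr
  · intro h
    have sa : IsSelfAdjoint y := by
      set w : A := ((imaginaryPart y : selfAdjoint A) : A) with hw
      have wsa : IsSelfAdjoint w := (imaginaryPart y).2
      have hn : ∀ t : ℝ, ‖w + algebraMap ℝ A t‖ ≤ Real.sqrt (r ^ 2 + t ^ 2) := by
        intro t
        refine le_trans ?_ (h t)
        have : w + algebraMap ℝ A t = ((imaginaryPart (y + algebraMap ℂ A (t * Complex.I)) : selfAdjoint A) : A) := by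
          rw [map_add]
          have e : algebraMap ℂ A (t * Complex.I) = Complex.I • (algebraMap ℝ A t) := by
            rw [IsScalarTower.algebraMap_apply ℝ ℂ A, Algebra.smul_def, ← map_mul, mul_comm]; rfl
          rw [e, imaginaryPart_I_smul]
          have := (IsSelfAdjoint.algebraMap A (.all t) : IsSelfAdjoint (algebraMap ℝ A t)).coe_realPart
          rw [AddSubgroup.coe_add, this]
        rw [this]
        exact imaginaryPart.norm_le (y + algebraMap ℂ A (t * Complex.I))
      have hb : ∀ t : ℝ, 0 ≤ Real.sqrt (r ^ 2 + t ^ 2) - t ∧ ‖w‖ ≤ Real.sqrt (r ^ 2 + t ^ 2) - t := by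
        intro t
        have h0 : 0 ≤ Real.sqrt (r ^ 2 + t ^ 2) - t := by
          rw [sub_nonneg]; apply Real.le_sqrt_of_sq_le; nlinarith
        refine ⟨h0, (nb w _ h0 ?_ ?_).2.2⟩
        · have s1 : IsSelfAdjoint (w + algebraMap ℝ A (-t)) := wsa.add (IsSelfAdjoint.algebraMap A (.all _))
          have := s1.neg_algebraMap_norm_le_self
          have h2 : algebraMap ℝ A ‖w + algebraMap ℝ A (-t)‖ ≤ algebraMap ℝ A (Real.sqrt (r ^ 2 + t ^ 2)) := by
            apply algebraMap_mono
            simpa using hn (-t)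
          rw [map_sub]
          rw [map_neg] at this h2
          calc _ = -algebraMap ℝ A (Real.sqrt (r ^ 2 + t ^ 2)) + algebraMap ℝ A t := by abel
            _ ≤ _ := by
              have := (neg_le_neg h2).trans this
              rw [← sub_eq_add_neg] at this
              rwa [le_sub_iff_add_le] at this
        · have s1 : IsSelfAdjoint (w + algebraMap ℝ A t) := wsa.add (IsSelfAdjoint.algebraMap A (.all _))
          have := s1.le_algebraMap_norm_self
          have h2 : algebraMap ℝ A ‖w + algebraMap ℝ A t‖ ≤ algebraMap ℝ A (Real.sqrt (r ^ 2 + t ^ 2)) := by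
            apply algebraMap_mono
            simpa using hn t
          rw [map_sub, le_sub_iff_add_le]
          exact this.trans h2
      have w0 : ‖w‖ = 0 := by
        by_contra hne
        have hp : 0 < ‖w‖ := lt_of_le_of_ne (norm_nonneg _) (Ne.symm hne)
        obtain ⟨h0, h1⟩ := hb (r ^ 2 / ‖w‖)
        have hs := Real.sq_sqrt (show 0 ≤ r ^ 2 + (r ^ 2 / ‖w‖) ^ 2 by positivity)
        set t := r ^ 2 / ‖w‖ with ht
        have htw : t * ‖w‖ = r ^ 2 := by rw [ht]; field_simp
        have t0 : 0 ≤ t := by positivity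
        nlinarith [Real.sqrt_nonneg (r ^ 2 + t ^ 2)]
      have w00 : imaginaryPart y = 0 := by
        apply Subtype.ext; rw [← hw, norm_eq_zero.1 w0]; rfl
      have := realPart_add_I_smul_imaginaryPart y
      rw [w00] at this
      simp at this
      rw [← this]
      exact (realPart y).2
    have h0 := h 0
    simp only [Complex.ofReal_zero, zero_mul, map_zero, add_zero] at h0
    have h1 : ‖y‖ ≤ r := by
      refine h0.trans ?_
      simp [Real.sqrt_sq hr]
    have m : algebraMap ℝ A ‖y‖ ≤ algebraMap ℝ A r := algebraMap_mono A h1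
    exact ⟨(neg_le_neg m).trans sa.neg_algebraMap_norm_le_self, sa.le_algebraMap_norm_self.trans m⟩
theorem ival (x : A) (R : ℝ) (hR : 0 ≤ R) : (0 ≤ x ∧ x ≤ algebraMap ℝ A R) ↔
    ∀ t : ℝ, ‖x - (algebraMap ℝ A (R / 2) - algebraMap ℂ A (t * Complex.I))‖ ≤
      Real.sqrt (R ^ 2 / 4 + t ^ 2) := by
  set y := x - algebraMap ℝ A (R / 2) with hy
  have e : ∀ t : ℝ, x - (algebraMap ℝ A (R / 2) - algebraMap ℂ A (t * Complex.I)) =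
      y + algebraMap ℂ A (t * Complex.I) := by intro t; rw [hy]; abel
  have e1 : (0 ≤ x ∧ x ≤ algebraMap ℝ A R) ↔
      (-algebraMap ℝ A (R / 2) ≤ y ∧ y ≤ algebraMap ℝ A (R / 2)) := by
    have : algebraMap ℝ A R = algebraMap ℝ A (R / 2) + algebraMap ℝ A (R / 2) := by
      rw [← map_add]; congr 1; ring
    rw [hy, this, sub_le_iff_le_add, neg_le_sub_iff_le_add, le_add_iff_nonneg_left]
  simp only [e, e1]
  have := ival_aux y (R / 2) (by positivity)
  have e3 : (R / 2) ^ 2 = R ^ 2 / 4 := by ring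
  rw [e3] at this
  exact this

theorem lub [WStarAlgebra A] (S : Set A) (hne : S.Nonempty) (hS : ∀ s ∈ S, 0 ≤ s ∧ s ≤ 1)
    (hd : DirectedOn (· ≤ ·) S) : ∃ z, IsLUB S z := by
  classical
  obtain ⟨s0, hs0⟩ := hne
  let U := upperBounds S
  let k : ℝ → ℝ → A := fun R t => algebraMap ℝ A (R / 2) - algebraMap ℂ A (t * Complex.I)
  have iv1 : ∀ s x : A, (0 ≤ x - s ∧ x - s ≤ 1) ↔ ∀ t : ℝ, ‖x - (s + k 1 t)‖ ≤
      Real.sqrt (1 ^ 2 / 4 + t ^ 2) := by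
    intro s x
    have := ival (x - s) 1 zero_le_one
    rw [map_one] at this
    rw [this]
    simp only [k, sub_sub]
  have iv2 : ∀ u x : A, (0 ≤ u - x ∧ u - x ≤ algebraMap ℝ A ‖u‖) ↔ ∀ t : ℝ,
      ‖x - (u - k ‖u‖ t)‖ ≤ Real.sqrt (‖u‖ ^ 2 / 4 + t ^ 2) := by
    intro u x
    rw [ival (u - x) _ (norm_nonneg u)]
    refine forall_congr' fun t => ?_
    rw [← norm_neg]
    have : -(u - x - (algebraMap ℝ A (‖u‖ / 2) - algebraMap ℂ A (t * Complex.I))) =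
      x - (u - k ‖u‖ t) := by simp only [k]; abel
    rw [this]
  let c : (S ⊕ U) × ℝ → A := fun i => Sum.elim (fun s : S => (s : A) + k 1 i.2)
    (fun u : U => (u : A) - k ‖(u : A)‖ i.2) i.1
  let r : (S ⊕ U) × ℝ → ℝ := fun i => Sum.elim (fun s : S => Real.sqrt (1 ^ 2 / 4 + i.2 ^ 2))
    (fun u : U => Real.sqrt (‖(u : A)‖ ^ 2 / 4 + i.2 ^ 2)) i.1
  haveI : Nonempty ((S ⊕ U) × ℝ) := ⟨(Sum.inl ⟨s0, hs0⟩, 0)⟩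
  obtain ⟨z, hz⟩ := ball_fip c r (by
    intro F
    let g : (S ⊕ U) × ℝ → S := fun i => Sum.elim (fun s : S => s) (fun _ => ⟨s0, hs0⟩) i.1
    haveI : Nonempty S := ⟨⟨s0, hs0⟩⟩
    obtain ⟨m, hm⟩ := Directed.finset_le (r := (· ≤ ·)) (f := fun s : S => (s : A))
      (directedOn_iff_directed.1 hd) (F.image g)
    refine ⟨m, ?_⟩
    rintro ⟨i | i, t⟩ hi
    · refine (iv1 i m).1 ⟨sub_nonneg.2 ?_, ?_⟩ t
      · exact hm i (Finset.mem_image.2 ⟨_, hi, rfl⟩)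
      · exact (sub_le_self _ (hS i i.2).1).trans (hS m m.2).2
    · have him : (m : A) ≤ i := i.2 m.2
      have i0 : 0 ≤ (i : A) := (hS m m.2).1.trans him
      refine (iv2 i m).1 ⟨sub_nonneg.2 him, ?_⟩ t
      exact (sub_le_self _ (hS m m.2).1).trans (IsSelfAdjoint.of_nonneg i0).le_algebraMap_norm_self)
  refine ⟨z, ?_, ?_⟩
  · intro s hs
    exact sub_nonneg.1 ((iv1 s z).2 fun t => hz (Sum.inl ⟨s, hs⟩, t)).1
  · intro u hu
    exact sub_nonneg.1 ((iv2 u z).2 fun t => hz (Sum.inr ⟨u, hu⟩, t)).1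

end
end S15

namespace S15
section
variable {A : Type*} [CStarAlgebra A]

theorem center_of_unitary {z : A} (hz : ∀ u ∈ unitary A, z * u = u * z) : z ∈ Set.center A := by
  rw [Semigroup.mem_center_iff]
  intro g
  have hg : g ∈ Submodule.span ℂ (unitary A : Set A) := by
    rw [CStarAlgebra.span_unitary]; trivial
  induction hg using Submodule.span_induction with
  | mem x hx => exact (hz x hx).symm
  | zero => simp
  | add x y _ _ hx hy => rw [add_mul, mul_add, hx, hy]
  | smul a x _ hx => rw [smul_mul_assoc, mul_smul_comm, hx]

variable [PartialOrder A] [StarOrderedRing A]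

theorem inv_facts {w r : A} (hw : 0 ≤ w) (h1 : r * (1 + w) = 1) (h2 : (1 + w) * r = 1) :
    0 ≤ r ∧ r ≤ 1 := by
  let U : Aˣ := ⟨1 + w, r, h2, h1⟩
  have h3 : (1 : A) ≤ (U : A) := by show (1 : A) ≤ 1 + w; simpa using hw
  have hU0 : 0 ≤ (U : A) := zero_le_one.trans h3
  refine ⟨?_, CStarAlgebra.inv_le_one (a := U) h3⟩
  have sr : star r = r := by
    have sa : star (1 + w) = 1 + w := (IsSelfAdjoint.of_nonneg hU0).star_eq
    have : star r * (1 + w) = 1 := by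
      have := congrArg star h2; rwa [star_mul, sa, star_one] at this
    calc star r = star r * ((1 + w) * r) := by rw [h2, mul_one]
      _ = r := by rw [← mul_assoc, this, one_mul]
  have := star_left_conjugate_nonneg hU0 r
  rw [sr] at this
  have e : r * (U : A) * r = r := by show r * (1 + w) * r = r; rw [h1, one_mul]
  rwa [e] at this

theorem inv_anti {w r w' r' : A} (hw : 0 ≤ w) (h1 : r * (1 + w) = 1) (h2 : (1 + w) * r = 1)
    (h1' : r' * (1 + w') = 1) (h2' : (1 + w') * r' = 1) (hww : w ≤ w') : r' ≤ r := by
  let U : Aˣ := ⟨1 + w, r, h2, h1⟩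
  let U' : Aˣ := ⟨1 + w', r', h2', h1'⟩
  have h3 : (1 : A) ≤ (U : A) := by show (1 : A) ≤ 1 + w; simpa using hw
  exact CStarAlgebra.inv_le_inv (a := U) (b := U') (zero_le_one.trans h3)
    (by show 1 + w ≤ 1 + w'; gcongr)

theorem inv_ex {w : A} (hw : 0 ≤ w) : ∃ r : A, r * (1 + w) = 1 ∧ (1 + w) * r = 1 := by
  have : IsUnit (1 + w) := CStarAlgebra.isUnit_of_le 1 (by simpa using hw)
  obtain ⟨U, hU⟩ := this
  exact ⟨(U⁻¹ : Aˣ), by rw [← hU]; simp, by rw [← hU]; simp⟩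

theorem ann1 [WStarAlgebra A] (h : A) (hh : ‖h‖ ≤ 1) : ∃ z ∈ Set.center A, z * z = z ∧ star z = z ∧
    z * h = 0 ∧ ∀ y, (∀ a, y * a * h = 0) → y * z = y := by
  let S : Set A := {s | ∃ w r, 0 ≤ w ∧ (∀ a, w * a * h = 0) ∧ r * (1 + w) = 1 ∧ (1 + w) * r = 1 ∧
    s = 1 - r}
  have h0S : (0 : A) ∈ S := ⟨0, 1, le_rfl, by simp, by simp, by simp, by simp⟩
  have hS : ∀ s ∈ S, 0 ≤ s ∧ s ≤ 1 := by
    rintro s ⟨w, r, hw, -, h1, h2, rfl⟩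
    obtain ⟨h3, h4⟩ := inv_facts hw h1 h2
    exact ⟨sub_nonneg.2 h4, sub_le_self _ h3⟩
  have hd : DirectedOn (· ≤ ·) S := by
    rintro s ⟨w, r, hw, hw', h1, h2, rfl⟩ s' ⟨v, q, hv, hv', k1, k2, rfl⟩
    obtain ⟨p, p1, p2⟩ := inv_ex (add_nonneg hw hv)
    refine ⟨1 - p, ⟨w + v, p, add_nonneg hw hv, ?_, p1, p2, rfl⟩, ?_, ?_⟩
    · intro a; rw [add_mul, add_mul, hw', hv', add_zero]
    · exact sub_le_sub_left (inv_anti hw h1 h2 p1 p2 (le_add_of_nonneg_right hv)) _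
    · exact sub_le_sub_left (inv_anti hv k1 k2 p1 p2 (le_add_of_nonneg_left hw)) _
  obtain ⟨z, hz⟩ := lub S ⟨0, h0S⟩ hS hd
  have z0 : 0 ≤ z := hz.1 h0S
  have z1 : z ≤ 1 := hz.2 fun s hs => (hS s hs).2
  have zsa : star z = z := (IsSelfAdjoint.of_nonneg z0).star_eq
  -- centrality
  have conj : ∀ u ∈ unitary A, z ≤ u * z * star u := by
    intro u hu
    obtain ⟨u1, u2⟩ := Unitary.mem_iff.1 hu
    apply hz.2
    rintro s ⟨w, r, hw, hw', h1, h2, rfl⟩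
    have : star u * (1 - r) * u ∈ S := by
      refine ⟨star u * w * u, star u * r * u, star_left_conjugate_nonneg hw u, ?_, ?_, ?_, ?_⟩
      · intro a
        have := hw' (u * a)
        simp only [mul_assoc] at this ⊢
        rw [this, mul_zero]
      · have e : star u * r * u * (1 + star u * w * u) =
          star u * (r * (1 + (u * star u) * w)) * u := by noncomm_ring
        rw [e, u2, one_mul, h1, mul_one, u1]
      · have e : (1 + star u * w * u) * (star u * r * u) =
          star u * (r + w * (u * star u) * r) * u := by noncomm_ring
        have e2 : r + w * r = 1 := by rw [← h2]; noncomm_ring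
        rw [e, u2, mul_one, e2, mul_one, u1]
      · rw [mul_sub, sub_mul, mul_one, u1]
    have h3 := star_right_conjugate_le_conjugate (hz.1 this) u
    have e : u * (star u * (1 - r) * u) * star u = (u * star u) * (1 - r) * (u * star u) := by
      noncomm_ring
    rwa [e, u2, one_mul, mul_one] at h3
  have zc : z ∈ Set.center A := by
    apply center_of_unitary
    intro u hu
    obtain ⟨u1, u2⟩ := Unitary.mem_iff.1 hu
    have c1 := conj u hu
    have c2 := conj (star u) (Unitary.star_mem hu)
    rw [star_star] at c2
    have c3 := star_right_conjugate_le_conjugate c2 u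
    have e : u * (star u * z * u) * star u = (u * star u) * z * (u * star u) := by noncomm_ring
    rw [e, u2, one_mul, mul_one] at c3
    have c4 := le_antisymm c1 c3
    conv_lhs => rw [c4]
    rw [mul_assoc, u1, mul_one]
  -- z annihilates h
  have zh : z * h = 0 := by
    set g := h * star h with hg
    have g0 : 0 ≤ g := mul_star_self_nonneg h
    have g1 : g ≤ 1 := by
      have : ‖g‖ ≤ 1 := by
        rw [hg, CStarRing.norm_self_mul_star]; nlinarith [norm_nonneg h]
      exact (CStarAlgebra.norm_le_one_iff_of_nonneg g g0).1 this
    have gsa : star g = g := (IsSelfAdjoint.of_nonneg g0).star_eq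
    have up : z ≤ (1 - g) * z * (1 - g) := by
      apply hz.2
      rintro s ⟨w, r, hw, hw', h1, h2, hs⟩
      have wg : w * g = 0 := by
        have := hw' 1
        rw [mul_one] at this
        rw [hg, ← mul_assoc, this, zero_mul]
      have gw : g * w = 0 := by
        have := congrArg star wg
        rwa [star_mul, gsa, (IsSelfAdjoint.of_nonneg hw).star_eq, star_zero] at this
      have s1 : s = r * w := by rw [hs, ← h1]; noncomm_ring
      have s2 : s = w * r := by rw [hs, ← h2]; noncomm_ring
      have sg : s * g = 0 := by rw [s1, mul_assoc, wg, mul_zero]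
      have gs : g * s = 0 := by rw [s2, ← mul_assoc, gw, zero_mul]
      have e : s = (1 - g) * s * (1 - g) := by
        rw [sub_mul, one_mul, gs, sub_zero, mul_sub, mul_one, sg, sub_zero]
      rw [e]
      have := star_right_conjugate_le_conjugate (hz.1 ⟨w, r, hw, hw', h1, h2, hs⟩) (1 - g)
      simpa [gsa] using this
    have cz := cc zc
    have e1 : (1 - g) * z * (1 - g) = z - z * g - (z * g - z * g * g) := by
      have : g * z = z * g := (cz g).symm
      rw [sub_mul, one_mul, mul_sub, mul_one, this]; noncomm_ring
    have p1 : 0 ≤ z * g := Commute.mul_nonneg z0 g0 (cz g)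
    have p2 : 0 ≤ z * g * (1 - g) := by
      apply Commute.mul_nonneg p1 (sub_nonneg.2 g1)
      apply Commute.sub_right (Commute.one_right _)
      exact Commute.mul_left (cz g) (Commute.refl _)
    have p3 : z * g ≤ 0 := by
      have e2 : z * g = (z - (1 - g) * z * (1 - g)) - z * g * (1 - g) := by
        rw [e1]; noncomm_ring
      rw [e2]
      have : z - (1 - g) * z * (1 - g) ≤ 0 := sub_nonpos.2 up
      exact (sub_le_self _ p2).trans this
    have p4 : z * g = 0 := le_antisymm p3 p1
    rw [← CStarRing.mul_star_self_eq_zero_iff, star_mul, zsa]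
    calc z * h * (star h * z) = z * g * z := by rw [hg]; noncomm_ring
      _ = 0 := by rw [p4, zero_mul]
  have big : ∀ y, (∀ a, y * a * h = 0) → y * z = y := by
    intro y hy
    set w := star y * y with hw
    have w0 : 0 ≤ w := star_mul_self_nonneg y
    have wsa : star w = w := (IsSelfAdjoint.of_nonneg w0).star_eq
    have wJ : ∀ a, w * a * h = 0 := by
      intro a
      have := hy a
      rw [hw]; simp only [mul_assoc] at this ⊢; rw [this, mul_zero]
    have n0 : 0 ≤ w * (1 - z) * w := by
      have := star_left_conjugate_nonneg (sub_nonneg.2 z1) w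
      rwa [wsa] at this
    have bd : ∀ n : ℕ, ‖w * (1 - z) * w‖ ≤ ‖w‖ / (n + 1) := by
      intro n
      set t : ℝ := n + 1 with ht
      have tp : 0 < t := by positivity
      have tw : 0 ≤ t • w := smul_nonneg tp.le w0
      obtain ⟨r, r1, r2⟩ := inv_ex tw
      obtain ⟨r3, r4⟩ := inv_facts tw r1 r2
      have m : 1 - r ≤ z := hz.1 ⟨t • w, r, tw, by
        intro a; rw [smul_mul_assoc, smul_mul_assoc, wJ, smul_zero], r1, r2, rfl⟩
      have le : w * (1 - z) * w ≤ w * r * w := by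
        have := star_left_conjugate_le_conjugate (sub_le_comm.1 m) w
        rwa [wsa] at this
      refine (CStarAlgebra.norm_le_norm_of_nonneg_of_le n0 le).trans ?_
      have e : w * r * w = t⁻¹ • ((1 - r) * w) := by
        have : (1 - r) = t • (w * r) := by rw [← r2]; rw [add_mul, smul_mul_assoc]; noncomm_ring
        rw [this, smul_mul_assoc, smul_smul, inv_mul_cancel₀ tp.ne', one_smul]
      have nr : ‖1 - r‖ ≤ 1 :=
        (CStarAlgebra.norm_le_one_iff_of_nonneg _ (sub_nonneg.2 r4)).2 (sub_le_self _ r3)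
      rw [e, norm_smul, norm_inv, Real.norm_of_nonneg tp.le, div_eq_inv_mul]
      gcongr
      calc ‖(1 - r) * w‖ ≤ ‖1 - r‖ * ‖w‖ := norm_mul_le _ _
        _ ≤ 1 * ‖w‖ := by gcongr
        _ = ‖w‖ := one_mul _
    have z00 : w * (1 - z) * w = 0 := by
      have lim : Filter.Tendsto (fun n : ℕ => ‖w‖ / ((n : ℝ) + 1)) Filter.atTop (nhds 0) := by
        have := (tendsto_one_div_add_atTop_nhds_zero_nat (𝕜 := ℝ)).const_mul ‖w‖
        simpa [div_eq_mul_inv] using this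
      have := ge_of_tendsto' lim bd
      exact norm_le_zero_iff.1 this
    have c1 : (1 - z) ∈ Set.center A := sub_center Set.one_mem_center zc
    have s1 : star (1 - z) = 1 - z := by rw [star_sub, star_one, zsa]
    have v0 : w * (1 - z) = 0 := by
      rw [← CStarRing.mul_star_self_eq_zero_iff, star_mul, wsa, s1]
      calc w * (1 - z) * ((1 - z) * w) = (1 - z) * w * ((1 - z) * w) := by rw [← cc c1 w]
        _ = (1 - z) * (w * (1 - z) * w) := by simp only [mul_assoc]
        _ = 0 := by rw [z00, mul_zero]
    have y0 : y * (1 - z) = 0 := by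
      rw [← CStarRing.star_mul_self_eq_zero_iff, star_mul, s1, mul_assoc, ← mul_assoc (star y), ← hw, v0,
        mul_zero]
    rw [mul_sub, mul_one, sub_eq_zero] at y0
    exact y0.symm
  refine ⟨z, zc, ?_, zsa, zh, big⟩
  apply big
  intro a
  rw [cc zc a, mul_assoc, zh, mul_zero]

theorem ann [WStarAlgebra A] (h : A) : ∃ z ∈ Set.center A, z * z = z ∧ star z = z ∧
    z * h = 0 ∧ ∀ y, (∀ a, y * a * h = 0) → y * z = y := by
  have np : 0 < ‖h‖ + 1 := by positivity
  have ne : (‖h‖ + 1)⁻¹ ≠ 0 := by positivity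
  obtain ⟨z, zc, zz, zs, zh, hy⟩ := ann1 ((‖h‖ + 1)⁻¹ • h) (by
    rw [norm_smul, norm_inv, Real.norm_of_nonneg np.le, inv_mul_le_one₀ np]; linarith)
  refine ⟨z, zc, zz, zs, ?_, ?_⟩
  · rw [mul_smul_comm] at zh
    exact (smul_eq_zero.1 zh).resolve_left ne
  · intro y h2
    apply hy
    intro a
    rw [mul_smul_comm, h2, smul_zero]

end
end S15

namespace S15
section
variable {A : Type*} [CStarAlgebra A]

theorem smul_center {z : A} (c : ℂ) (hz : z ∈ Set.center A) : c • z ∈ Set.center A := by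
  rw [Semigroup.mem_center_iff]
  intro g
  rw [mul_smul_comm, smul_mul_assoc, cc hz]

variable [PartialOrder A] [StarOrderedRing A]

structure Good (E b : A) : Prop where
  nn : 0 ≤ b
  le : b ≤ E
  eb : E * b = b
  be : b * E = b
  co : ∀ a, b * (E * a * E) = (E * a * E) * b

theorem Good.step [WStarAlgebra A] {E b : A} (EE : E * E = E) (Es : star E = E) (hb : Good E b) :
    ∃ e ∈ Set.center A, e * e = e ∧ star e = e ∧ Good E (b + b - e * E) := by
  have bs : star b = b := (IsSelfAdjoint.of_nonneg hb.nn).star_eq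
  set h := b + b - E with hh
  have hs : IsSelfAdjoint h := by
    show star h = h
    rw [hh, star_sub, star_add, bs, Es]
  obtain ⟨p, q, p0, q0, hpq, pq, qp, pc⟩ : ∃ p q : A, 0 ≤ p ∧ 0 ≤ q ∧ p - q = h ∧ p * q = 0 ∧ q * p = 0 ∧
      ∀ x, h * x = x * h → p * x = x * p := by
    refine ⟨h⁺, h⁻, CFC.posPart_nonneg h, CFC.negPart_nonneg h, CFC.posPart_sub_negPart h hs,
      CFC.posPart_mul_negPart h, CFC.negPart_mul_posPart h, ?_⟩
    intro x hx
    rw [CFC.posPart_def]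
    exact Commute.cfcₙ_real (show Commute h x from hx) _
  have Eh : E * h = h := by rw [hh, mul_sub, mul_add, hb.eb, EE]
  have hE : h * E = h := by rw [hh, sub_mul, add_mul, hb.be, EE]
  have ps : star p = p := (IsSelfAdjoint.of_nonneg p0).star_eq
  have ph : p * p = p * h := by rw [← hpq, mul_sub, pq, sub_zero]
  have pE : p * E = p := by
    have : p * (1 - E) = 0 := by
      rw [← CStarRing.star_mul_self_eq_zero_iff, star_mul, ps, mul_assoc, ← mul_assoc p, ph, mul_assoc p,
        mul_sub h, hE, mul_one, sub_self, mul_zero, mul_zero]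
    rw [mul_sub, mul_one, sub_eq_zero] at this
    exact this.symm
  have Ep : E * p = p := by rw [← pc E (by rw [hE, Eh]), pE]
  have qeq : q = p - h := by rw [← hpq]; abel
  have qE : q * E = q := by rw [qeq, sub_mul, pE, hE]
  have hco : ∀ a, h * (E * a * E) = (E * a * E) * h := by
    intro a
    have e1 : E * (E * a * E) = (E * a * E) * E := by
      simp only [mul_assoc, EE]; simp only [← mul_assoc, EE]
    rw [hh, sub_mul, add_mul, mul_sub, mul_add, hb.co, e1]
  have pco : ∀ a, p * (E * a * E) = (E * a * E) * p := fun a => pc _ (hco a)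
  have qap : ∀ a, q * a * p = 0 := by
    intro a
    calc q * a * p = q * ((E * a * E) * p) := by
          conv_lhs => rw [← qE, ← Ep]
          simp only [mul_assoc]
      _ = 0 := by rw [← pco, ← mul_assoc, qp, zero_mul]
  obtain ⟨z, zc, zz, zs, zp, hz⟩ := ann p
  have qz : q * z = q := hz q qap
  have zq : z * q = q := by rw [cc zc, qz]
  have ec : (1 - z) ∈ Set.center A := sub_center Set.one_mem_center zc
  have z0 : 0 ≤ z := by have := star_mul_self_nonneg z; rwa [zs, zz] at this
  have ez : (1 - z) * (1 - z) = 1 - z := by rw [sub_mul, one_mul, mul_sub, mul_one, zz]; abel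
  have es : star (1 - z) = 1 - z := by rw [star_sub, star_one, zs]
  have e0 : 0 ≤ 1 - z := by have := star_mul_self_nonneg (1 - z); rwa [es, ez] at this
  have zh : z * h = - q := by rw [← hpq, mul_sub, zp, zq, zero_sub]
  refine ⟨1 - z, ec, ez, es, ?_, ?_, ?_, ?_, ?_⟩
  · have e : b + b - (1 - z) * E = p + z * (b + b) := by
      have : b + b = h + E := by rw [hh]; abel
      rw [this, mul_add, zh, sub_mul, one_mul, ← hpq]; abel
    rw [e]
    exact add_nonneg p0 (Commute.mul_nonneg z0 (add_nonneg hb.nn hb.nn) (cc zc _))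
  · have e : E - (b + b - (1 - z) * E) = (1 - z) * ((E - b) + (E - b)) + q := by
      have : (E - b) + (E - b) = E - h := by rw [hh]; abel
      have h2 : b + b = h + E := by rw [hh]; abel
      rw [this, h2, mul_sub, sub_mul 1 z h, zh, one_mul, ← hpq]; abel
    rw [← sub_nonneg, e]
    have := sub_nonneg.2 hb.le
    exact add_nonneg (Commute.mul_nonneg e0 (add_nonneg this this) (cc ec _)) q0
  · rw [mul_sub, mul_add, hb.eb, ← mul_assoc, ← cc ec E, mul_assoc, EE]
  · rw [sub_mul, add_mul, hb.be, mul_assoc, EE]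
  · intro a
    have e1 : E * (E * a * E) = (E * a * E) * E := by
      simp only [mul_assoc, EE]; simp only [← mul_assoc, EE]
    have e2 : (1 - z) * E * (E * a * E) = (E * a * E) * ((1 - z) * E) := by
      rw [mul_assoc (1 - z), e1, ← mul_assoc (1 - z), cc ec (E * a * E), mul_assoc (E * a * E)]
    rw [sub_mul, add_mul, mul_sub, mul_add, hb.co, e2]

theorem Good.ex [WStarAlgebra A] {E b : A} (EE : E * E = E) (Es : star E = E) (hb : Good E b) :
    ∃ z ∈ Set.center A, z * E = b := by
  choose F hF using fun x : {x : A // Good E x} => x.2.step EE Es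
  let B : ℕ → {x : A // Good E x} := fun k =>
    Nat.rec ⟨b, hb⟩ (fun _ x => ⟨x.1 + x.1 - F x * E, (hF x).2.2.2⟩) k
  have B0 : (B 0).1 = b := rfl
  have BS : ∀ k, (B (k + 1)).1 = (B k).1 + (B k).1 - F (B k) * E := fun k => rfl
  let f : ℕ → A := fun k => ((1 / 2 : ℝ) ^ k * (1 / 2)) • F (B k)
  have fn : ∀ k, ‖f k‖ ≤ (1 / 2 : ℝ) ^ k := by
    intro k
    have h1 : ‖F (B k)‖ ≤ 1 := IsStarProjection.norm_le _ ⟨(hF (B k)).2.1, (hF (B k)).2.2.1⟩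
    show ‖((1 / 2 : ℝ) ^ k * (1 / 2)) • F (B k)‖ ≤ _
    rw [norm_smul, Real.norm_of_nonneg (by positivity)]
    have : 0 < (1 / 2 : ℝ) ^ k := by positivity
    nlinarith [norm_nonneg (F (B k))]
  have hs : Summable f := Summable.of_norm_bounded summable_geometric_two fn
  refine ⟨∑' k, f k, ?_, ?_⟩
  · rw [Semigroup.mem_center_iff]
    intro g
    rw [← hs.tsum_mul_right, ← hs.tsum_mul_left]
    congr 1
    funext k
    show g * (_ • F (B k)) = (_ • F (B k)) * g
    rw [mul_smul_comm, smul_mul_assoc, cc (hF (B k)).1]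
  · have ps : ∀ N, ∑ k ∈ Finset.range N, f k * E = b - ((1 / 2 : ℝ) ^ N) • (B N).1 := by
      intro N
      induction N with
      | zero => simp [B0]
      | succ N ih =>
        rw [Finset.sum_range_succ, ih, BS]
        show _ + (((1 / 2 : ℝ) ^ N * (1 / 2)) • F (B N)) * E = _
        rw [smul_mul_assoc, pow_succ]
        generalize (1 / 2 : ℝ) ^ N = t
        module
    have t1 : Filter.Tendsto (fun N => ∑ k ∈ Finset.range N, f k * E) Filter.atTop
        (nhds ((∑' k, f k) * E)) := (hs.hasSum.mul_right E).tendsto_sum_nat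
    have t2 : Filter.Tendsto (fun N => b - ((1 / 2 : ℝ) ^ N) • (B N).1) Filter.atTop (nhds b) := by
      have t3 : Filter.Tendsto (fun N => ((1 / 2 : ℝ) ^ N) • (B N).1) Filter.atTop (nhds 0) := by
        apply squeeze_zero_norm (a := fun N => (1 / 2 : ℝ) ^ N)
        · intro N
          have h1 : ‖(B N).1‖ ≤ 1 := by
            have h2 : ‖E‖ ≤ 1 := IsStarProjection.norm_le _ ⟨EE, Es⟩
            exact (CStarAlgebra.norm_le_norm_of_nonneg_of_le (B N).2.nn (B N).2.le).trans h2
          rw [norm_smul, Real.norm_of_nonneg (by positivity)]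
          have : 0 < (1 / 2 : ℝ) ^ N := by positivity
          nlinarith
        · exact tendsto_pow_atTop_nhds_zero_of_lt_one (by norm_num) (by norm_num)
      simpa using tendsto_const_nhds (x := b) |>.sub t3
    simp only [ps] at t1
    exact tendsto_nhds_unique t1 t2

theorem corner_sa [WStarAlgebra A] {E c : A} (EE : E * E = E) (Es : star E = E) (cs : star c = c)
    (hc : E * c * E = c) (co : ∀ a, c * (E * a * E) = (E * a * E) * c) :
    ∃ z ∈ Set.center A, z * E = c := by
  have Ec : E * c = c := by rw [← hc, ← mul_assoc, ← mul_assoc, EE]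
  have cE : c * E = c := by rw [← hc, mul_assoc, EE]
  obtain ⟨r, hr⟩ : ∃ r : ℝ, r = ‖c‖ + 1 := ⟨_, rfl⟩
  have rp : 0 < r := by rw [hr]; positivity
  have sa : IsSelfAdjoint c := cs
  have up : c ≤ r • E := by
    have h1 : c ≤ algebraMap ℝ A r := sa.le_algebraMap_norm_self.trans (by
      apply algebraMap_mono; rw [hr]; linarith)
    have := star_left_conjugate_le_conjugate h1 E
    rw [Es, hc, Algebra.algebraMap_eq_smul_one, mul_smul_comm, mul_one, smul_mul_assoc, EE] at this
    exact this
  have dn : - (r • E) ≤ c := by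
    have h1 : - algebraMap ℝ A r ≤ c := le_trans (neg_le_neg (by
      apply algebraMap_mono; rw [hr]; linarith)) sa.neg_algebraMap_norm_le_self
    have := star_left_conjugate_le_conjugate h1 E
    rw [Es, hc, Algebra.algebraMap_eq_smul_one, mul_neg, neg_mul, mul_smul_comm, mul_one, smul_mul_assoc, EE] at this
    exact this
  have e1 : ∀ a, E * (E * a * E) = (E * a * E) * E := by
    intro a
    simp only [mul_assoc, EE]; simp only [← mul_assoc, EE]
  have good : Good E ((2 * r)⁻¹ • (c + r • E)) := by
    refine ⟨?_, ?_, ?_, ?_, ?_⟩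
    · apply smul_nonneg (by positivity)
      have := neg_le_iff_add_nonneg.1 dn
      exact this
    · have h2 : E = (2 * r)⁻¹ • (r • E + r • E) := by
        rw [← add_smul, smul_smul, ← two_mul, inv_mul_cancel₀ (by positivity), one_smul]
      conv_rhs => rw [h2]
      apply smul_le_smul_of_nonneg_left _ (by positivity)
      gcongr
    · rw [mul_smul_comm, mul_add E, mul_smul_comm, EE, Ec]
    · rw [smul_mul_assoc, add_mul, smul_mul_assoc, EE, cE]
    · intro a
      rw [mul_smul_comm, mul_add (E * a * E), mul_smul_comm, smul_mul_assoc, add_mul, smul_mul_assoc, co, e1]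
  obtain ⟨z, zc, hz⟩ := good.ex EE Es
  refine ⟨(2 * r) • z - r • 1, sub_center ?_ ?_, ?_⟩
  · exact smul_center ((2 * r : ℝ) : ℂ) zc
  · exact smul_center ((r : ℝ) : ℂ) Set.one_mem_center
  · rw [sub_mul, smul_mul_assoc, hz, smul_smul, mul_inv_cancel₀ (by positivity), one_smul, smul_mul_assoc,
      one_mul, add_sub_cancel_right]

theorem corner [WStarAlgebra A] {E b : A} (EE : E * E = E) (Es : star E = E)
    (hc : E * b * E = b) (co : ∀ a, b * (E * a * E) = (E * a * E) * b) :
    ∃ z ∈ Set.center A, z * E = b := by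
  have hc' : E * star b * E = star b := by
    have := congrArg star hc
    rw [star_mul, star_mul, Es, ← mul_assoc] at this
    exact this
  have co' : ∀ a, star b * (E * a * E) = (E * a * E) * star b := by
    intro a
    have := congrArg star (co (star a))
    simp only [star_mul, Es, star_star, ← mul_assoc] at this ⊢
    exact this.symm
  obtain ⟨z1, c1, h1⟩ := corner_sa EE Es (c := b + star b) (by rw [star_add, star_star, add_comm])
    (by rw [mul_add, add_mul, hc, hc']) (fun a => by rw [add_mul, mul_add, co, co'])
  obtain ⟨z2, c2, h2⟩ := corner_sa EE Es (c := Complex.I • (b - star b))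
    (by rw [star_smul, star_sub, star_star]; simp [smul_sub]; abel)
    (by rw [mul_smul_comm, smul_mul_assoc, mul_sub, sub_mul, hc, hc'])
    (fun a => by rw [smul_mul_assoc, mul_smul_comm, sub_mul, mul_sub, co, co'])
  refine ⟨(1 / 2 : ℂ) • z1 - (Complex.I / 2) • z2, sub_center (smul_center _ c1) (smul_center _ c2), ?_⟩
  rw [sub_mul, smul_mul_assoc, smul_mul_assoc, h1, h2, smul_smul]
  have : Complex.I / 2 * Complex.I = -(1 / 2) := by
    rw [div_mul_eq_mul_div, Complex.I_mul_I]; norm_num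
  rw [this]
  module

end

theorem mkCtx {A : Type*} [CStarAlgebra A] [WStarAlgebra A] {P : A} (PP : P * P = P) (Ps : star P = P)
    (core : ∀ z : A, z ∈ Set.center A → z * z = z → star z = z → z * P = z → z = 0)
    (carr : ∀ z : A, z ∈ Set.center A → z * z = z → star z = z → z * P = P → z = 1) :
    Ctx P (1 - P) := by
  let _ := CStarAlgebra.spectralOrder A
  have _ := CStarAlgebra.spectralOrderedRing A
  have Qs : star (1 - P) = 1 - P := by rw [star_sub, star_one, Ps]
  have QQ : (1 - P) * (1 - P) = 1 - P := by rw [sub_mul, one_mul, mul_sub, mul_one, PP]; abel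
  have fP : ∀ x : A, (∀ a, x * a * P = 0) → x = 0 := by
    intro x hx
    obtain ⟨z, zc, zz, zs, zp, hz⟩ := ann P
    have h1 : (1 - z) = 1 := by
      apply carr _ (sub_center Set.one_mem_center zc)
      · rw [sub_mul, one_mul, mul_sub, mul_one, zz]; abel
      · rw [star_sub, star_one, zs]
      · rw [sub_mul, one_mul, zp, sub_zero]
    have z0 : z = 0 := by simpa using h1
    rw [← hz x hx, z0, mul_zero]
  have fQ : ∀ x : A, (∀ a, x * a * (1 - P) = 0) → x = 0 := by
    intro x hx
    obtain ⟨z, zc, zz, zs, zp, hz⟩ := ann (1 - P)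
    have z0 : z = 0 := by
      apply core _ zc zz zs
      rw [mul_sub, mul_one, sub_eq_zero] at zp
      exact zp.symm
    rw [← hz x hx, z0, mul_zero]
  have gE : ∀ E : A, star E = E → (∀ x : A, (∀ a, x * a * E = 0) → x = 0) →
      ∀ x : A, (∀ a, E * a * x = 0) → x = 0 := by
    intro E Es fE x hx
    rw [← star_eq_zero]
    apply fE
    intro a
    have := congrArg star (hx (star a))
    rwa [star_mul, star_mul, star_star, Es, star_zero, ← mul_assoc] at this
  exact {
    PP := PP
    QQ := QQ
    PQ := by rw [mul_sub, mul_one, PP, sub_self]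
    QP := by rw [sub_mul, one_mul, PP, sub_self]
    one := by abel
    two := fun x hx => by
      rw [← two_smul ℂ x] at hx
      exact (smul_eq_zero.1 hx).resolve_left two_ne_zero
    fP := fP
    fQ := fQ
    gP := gE P Ps fP
    gQ := gE _ Qs fQ
    sp := fun x hx => by
      have h1 := hx (star x)
      have h2 : star x * x = 0 := by
        rw [← CStarRing.star_mul_self_eq_zero_iff, star_mul, star_star, mul_assoc, ← mul_assoc x, h1, mul_zero]
      exact CStarRing.star_mul_self_eq_zero_iff x |>.1 h2
    cP := fun b => corner PP Ps
    cQ := fun b => corner QQ Qs }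

end S15

theorem stmt15 {A : Type*} [CStarAlgebra A] [WStarAlgebra A]
    (hP : ∃ P : A, P * P = P ∧ star P = P ∧
      (∀ z : A, z ∈ Set.center A → z * z = z → star z = z → z * P = z → z = 0) ∧
      (∀ z : A, z ∈ Set.center A → z * z = z → star z = z → z * P = P → z = 1))
    (n : ℕ) (hn : 2 ≤ n) (φ : A → A)
    (hφ : ∀ x : Fin n → A,
      φ (pComm15 (List.ofFn x))
        = ∑ i, pComm15 (List.ofFn (Function.update x i (φ (x i))))) :
    ∃ d f : A → A,
      (∀ x y : A, d (x + y) = d x + d y) ∧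
      (∀ x y : A, d (x * y) = d x * y + x * d y) ∧
      (∀ x : A, f x ∈ Set.center A) ∧
      (∀ x : A, φ x = d x + f x) ∧
      (∀ x : Fin n → A, f (pComm15 (List.ofFn x)) = 0) := by
  obtain ⟨P, PP, Ps, core, carr⟩ := hP
  refine S15.alg_main (S15.mkCtx PP Ps core carr) ?_ n hn φ hφ
  intro k x hk hx
  rw [← Nat.cast_smul_eq_nsmul ℂ] at hx
  exact (smul_eq_zero.1 hx).resolve_left (by exact_mod_cast hk)
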